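/- arXiv:2003.12489 — 7 statements merged into one kernel-verified Lean document; each statement's English description precedes it below -/
import Mathlib

section
/- Let X, Y, Z be random variables taking finitely many values and let U_X, U_Y, U_Z be random variables such that U_X, U_Y, U_Z and the triple (X,Y,Z) are mutually independent. Set X̄ = f(X,U_X), Ȳ = g(Y,U_Y), Z̄ = h(Z,U_Z) for arbitrary functions f, g, h (local stochastic operations). Then I(X̄ : Ȳ | Z̄) ≤ I(X : Y | Z) + I((X,Y) : Z) − I((X,Y) : Z̄). In particular, the lack of monotonicity of conditional mutual information under local operations is bounded by the amount I((X,Y):Z) − I((X,Y):Z̄) by which the local operation on the conditioning system decorrelates it from (X,Y). -/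
/-- Probability that the random variable `X` (on the finite sample space `Ω`
with probability mass function `p`) takes the value `s`. -/
noncomputable def pOf {Ω S : Type*} [Fintype Ω] [DecidableEq S]
    (p : Ω → ℝ) (X : Ω → S) (s : S) : ℝ :=
  ∑ ω, if X ω = s then p ω else 0

/-- Shannon entropy (natural logarithm, `0 log 0 = 0`) of a random variable `X`. -/
noncomputable def ent {Ω S : Type*} [Fintype Ω] [Fintype S] [DecidableEq S]
    (p : Ω → ℝ) (X : Ω → S) : ℝ :=
  ∑ s, Real.negMulLog (pOf p X s)

/-- Mutual information `I(X : Y) = H(X) + H(Y) - H(X,Y)`. -/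
noncomputable def mi {Ω S T : Type*} [Fintype Ω] [Fintype S] [DecidableEq S]
    [Fintype T] [DecidableEq T] (p : Ω → ℝ) (X : Ω → S) (Y : Ω → T) : ℝ :=
  ent p X + ent p Y - ent p (fun ω => (X ω, Y ω))

/-- Conditional mutual information
`I(X : Y | Z) = H(X,Z) + H(Y,Z) - H(X,Y,Z) - H(Z)`. -/
noncomputable def cmi {Ω S T U : Type*} [Fintype Ω] [Fintype S] [DecidableEq S]
    [Fintype T] [DecidableEq T] [Fintype U] [DecidableEq U]
    (p : Ω → ℝ) (X : Ω → S) (Y : Ω → T) (Z : Ω → U) : ℝ :=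
  ent p (fun ω => (X ω, Z ω)) + ent p (fun ω => (Y ω, Z ω))
    - ent p (fun ω => ((X ω, Y ω), Z ω)) - ent p Z

section Helpers

variable {Ω S T R : Type*} [Fintype Ω] [Fintype S] [DecidableEq S]
    [Fintype T] [DecidableEq T] [Fintype R] [DecidableEq R]

theorem sum_mul_comp (p : Ω → ℝ) (X : Ω → S) (F : S → ℝ) :
    ∑ ω, p ω * F (X ω) = ∑ s, pOf p X s * F s := by
  simp only [pOf, Finset.sum_mul]
  rw [Finset.sum_comm]
  refine Finset.sum_congr rfl fun ω _ => ?_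
  simp [ite_mul]

theorem ent_eq (p : Ω → ℝ) (X : Ω → S) :
    ent p X = ∑ ω, p ω * (-Real.log (pOf p X (X ω))) := by
  rw [sum_mul_comp p X (fun s => -Real.log (pOf p X s))]
  simp [ent, Real.negMulLog]

theorem ent_congr (p : Ω → ℝ) (X : Ω → S) (Y : Ω → T)
    (h : ∀ ω ω', X ω = X ω' ↔ Y ω = Y ω') : ent p X = ent p Y := by
  rw [ent_eq, ent_eq]
  refine Finset.sum_congr rfl fun ω _ => ?_
  have : pOf p X (X ω) = pOf p Y (Y ω) := by
    simp only [pOf, h]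
  rw [this]

theorem pOf_nonneg (p : Ω → ℝ) (hp : ∀ ω, 0 ≤ p ω) (X : Ω → S) (s : S) : 0 ≤ pOf p X s := by
  unfold pOf
  refine Finset.sum_nonneg fun ω _ => ?_
  split_ifs
  · exact hp ω
  · exact le_rfl

theorem pOf_pos (p : Ω → ℝ) (hp : ∀ ω, 0 ≤ p ω) (X : Ω → S) (ω : Ω) (h : 0 < p ω) :
    0 < pOf p X (X ω) := by
  unfold pOf
  refine Finset.sum_pos' (fun ω _ => ?_) ⟨ω, Finset.mem_univ _, by simpa using h⟩
  split_ifs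
  · exact hp _
  · exact le_rfl

theorem sum_pOf (p : Ω → ℝ) (X : Ω → S) : ∑ s, pOf p X s = ∑ ω, p ω := by
  have := sum_mul_comp p X (fun _ => 1)
  simpa using this.symm

theorem pOf_comp (p : Ω → ℝ) (X : Ω → S) (φ : S → T) (t : T) :
    pOf p (fun ω => φ (X ω)) t = ∑ s, if φ s = t then pOf p X s else 0 := by
  have := sum_mul_comp p X (fun s => if φ s = t then 1 else 0)
  simpa [pOf] using this

theorem pOf_marg (p : Ω → ℝ) (X : Ω → S) (Y : Ω → T) (t : T) :
    ∑ s, pOf p (fun ω => (X ω, Y ω)) (s, t) = pOf p Y t := by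
  unfold pOf
  rw [Finset.sum_comm]
  refine Finset.sum_congr rfl fun ω _ => ?_
  by_cases h : Y ω = t <;> simp [h]

theorem ssa (p : Ω → ℝ) (hp : ∀ ω, 0 ≤ p ω) (hp1 : ∑ ω, p ω = 1)
    (X : Ω → S) (Y : Ω → T) (Z : Ω → R) :
    ent p (fun ω => (X ω, Y ω, Z ω)) + ent p Z ≤
      ent p (fun ω => (X ω, Z ω)) + ent p (fun ω => (Y ω, Z ω)) := by
  rw [ent_eq, ent_eq, ent_eq, ent_eq, ← Finset.sum_add_distrib, ← Finset.sum_add_distrib]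
  set P := pOf p (fun ω => (X ω, Y ω, Z ω)) with hP
  set A := pOf p (fun ω => (X ω, Z ω)) with hA
  set B := pOf p (fun ω => (Y ω, Z ω)) with hB
  set C := pOf p Z with hC
  let G : S × T × R → ℝ := fun q => A (q.1, q.2.2) * B (q.2.1, q.2.2) / (P q * C q.2.2)
  have hle : ∑ ω, p ω * G (X ω, Y ω, Z ω) ≤ 1 := by
    rw [sum_mul_comp p (fun ω => (X ω, Y ω, Z ω)) G]
    have h1 : ∀ q : S × T × R, pOf p (fun ω => (X ω, Y ω, Z ω)) q * G q
        ≤ A (q.1, q.2.2) * B (q.2.1, q.2.2) / C q.2.2 := by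
      intro q
      have a0 : 0 ≤ A (q.1, q.2.2) := pOf_nonneg p hp _ _
      have b0 : 0 ≤ B (q.2.1, q.2.2) := pOf_nonneg p hp _ _
      have c0 : 0 ≤ C q.2.2 := pOf_nonneg p hp _ _
      rw [← hP]
      by_cases hq : P q = 0
      · rw [hq, zero_mul]; positivity
      · apply le_of_eq
        simp only [G]
        rw [← mul_div_assoc, mul_div_mul_left _ _ hq]
    refine (Finset.sum_le_sum fun q _ => h1 q).trans ?_
    rw [Fintype.sum_prod_type]
    simp only [Fintype.sum_prod_type]
    have : ∀ z, ∑ x, ∑ y, A (x, z) * B (y, z) / C z = C z := by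
      intro z
      simp only [← Finset.sum_div, ← Finset.mul_sum, ← Finset.sum_mul]
      rw [hA, hB, pOf_marg, pOf_marg, ← hC]
      exact mul_self_div_self _
    calc ∑ x, ∑ y, ∑ z, A (x, z) * B (y, z) / C z
        = ∑ z, ∑ x, ∑ y, A (x, z) * B (y, z) / C z := by
          rw [Finset.sum_comm]
          conv_rhs => rw [Finset.sum_comm]; enter [2, x]; rw [Finset.sum_comm]
          rw [Finset.sum_comm]
      _ = 1 := by simp only [this]; rw [hC, sum_pOf, hp1]
      _ ≤ 1 := le_rfl
  have key : ∀ ω, p ω * -Real.log (P (X ω, Y ω, Z ω)) + p ω * -Real.log (C (Z ω)) + p ω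
      ≤ (p ω * -Real.log (A (X ω, Z ω)) + p ω * -Real.log (B (Y ω, Z ω)))
        + p ω * G (X ω, Y ω, Z ω) := by
    intro ω
    rcases (hp ω).eq_or_lt with h0 | h0
    · simp [← h0]
    have a0 : 0 < A (X ω, Z ω) := pOf_pos p hp (fun ω => (X ω, Z ω)) ω h0
    have b0 : 0 < B (Y ω, Z ω) := pOf_pos p hp (fun ω => (Y ω, Z ω)) ω h0
    have c0 : 0 < C (Z ω) := pOf_pos p hp Z ω h0
    have q0 : 0 < P (X ω, Y ω, Z ω) := pOf_pos p hp (fun ω => (X ω, Y ω, Z ω)) ω h0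
    have g0 : 0 < G (X ω, Y ω, Z ω) := by simp only [G]; positivity
    have hl := Real.log_le_sub_one_of_pos g0
    have hg : Real.log (G (X ω, Y ω, Z ω)) = Real.log (A (X ω, Z ω)) + Real.log (B (Y ω, Z ω))
        - (Real.log (P (X ω, Y ω, Z ω)) + Real.log (C (Z ω))) := by
      simp only [G]
      rw [Real.log_div (by positivity) (by positivity), Real.log_mul a0.ne' b0.ne',
        Real.log_mul q0.ne' c0.ne']
    rw [hg] at hl
    nlinarith [mul_le_mul_of_nonneg_left hl h0.le]
  have hs := Finset.sum_le_sum (s := Finset.univ) fun ω _ => key ω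
  rw [Finset.sum_add_distrib, hp1, Finset.sum_add_distrib (g := fun ω => p ω * G _)] at hs
  linarith

/-- Independence of two finite random variables. -/
def Ind (p : Ω → ℝ) (X : Ω → S) (Y : Ω → T) : Prop :=
  ∀ s t, pOf p (fun ω => (X ω, Y ω)) (s, t) = pOf p X s * pOf p Y t

theorem Ind.of_factor (p : Ω → ℝ) (hp1 : ∑ ω, p ω = 1) (X : Ω → S) (Y : Ω → T) (q : T → ℝ)
    (h : ∀ s t, pOf p (fun ω => (X ω, Y ω)) (s, t) = pOf p X s * q t) : Ind p X Y := by
  intro s t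
  have : pOf p Y t = q t := by
    rw [← pOf_marg p X Y]
    simp only [h, ← Finset.sum_mul]
    rw [sum_pOf, hp1, one_mul]
  rw [h, this]

theorem Ind.comp {p : Ω → ℝ} {X : Ω → S} {Y : Ω → T} (h : Ind p X Y) (φ : T → R) :
    Ind p X (fun ω => φ (Y ω)) := by
  intro s r
  have h1 := sum_mul_comp p (fun ω => (X ω, Y ω))
    (fun q => if (q.1, φ q.2) = (s, r) then 1 else 0)
  have h2 : pOf p (fun ω => (X ω, φ (Y ω))) (s, r)
      = ∑ q, pOf p (fun ω => (X ω, Y ω)) q * (if (q.1, φ q.2) = (s, r) then 1 else 0) := by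
    rw [← h1]
    simp [pOf]
  rw [h2, Fintype.sum_prod_type, pOf_comp p Y φ, Finset.mul_sum, Finset.sum_eq_single s]
  · refine Finset.sum_congr rfl fun t _ => ?_
    rw [h s t]
    by_cases ht : φ t = r <;> simp [ht]
  · intro b _ hb
    simp [hb]
  · simp

theorem Ind.ent_add {p : Ω → ℝ} (hp : ∀ ω, 0 ≤ p ω) {X : Ω → S} {Y : Ω → T} (h : Ind p X Y) :
    ent p (fun ω => (X ω, Y ω)) = ent p X + ent p Y := by
  rw [ent_eq, ent_eq, ent_eq, ← Finset.sum_add_distrib]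
  refine Finset.sum_congr rfl fun ω _ => ?_
  rcases (hp ω).eq_or_lt with h0 | h0
  · simp [← h0]
  rw [h, Real.log_mul (pOf_pos p hp X ω h0).ne' (pOf_pos p hp Y ω h0).ne']
  ring

end Helpers

/-- Data processing: `H(B|F) ≥ H(B|A)` for `F = φ(A,U)`, `U` independent of `(A,B)`. -/
theorem dataProc {Ω S T A R : Type*} [Fintype Ω] [Fintype S] [DecidableEq S]
    [Fintype T] [DecidableEq T] [Fintype A] [DecidableEq A] [Fintype R] [DecidableEq R]
    (p : Ω → ℝ) (hp : ∀ ω, 0 ≤ p ω) (hp1 : ∑ ω, p ω = 1)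
    (X : Ω → S) (Y : Ω → T) (W : Ω → A) (φ : S → A → R)
    (hI : Ind p W (fun ω => (X ω, Y ω))) :
    ent p (fun ω => (X ω, Y ω)) - ent p X ≤
      ent p (fun ω => (φ (X ω) (W ω), Y ω)) - ent p (fun ω => φ (X ω) (W ω)) := by
  have h1 := ssa p hp hp1 Y (fun ω => (W ω, X ω)) (fun ω => φ (X ω) (W ω))
  have h2 := hI.ent_add hp
  have h3 : ent p (fun ω => (W ω, X ω)) = _ := (hI.comp Prod.fst).ent_add hp
  have e1 : ent p (fun ω => (Y ω, (W ω, X ω), φ (X ω) (W ω))) =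
      ent p (fun ω => (W ω, (X ω, Y ω))) := by
    apply ent_congr
    intro ω ω'
    simp only [Prod.mk.injEq]
    constructor
    · rintro ⟨a, ⟨b, c⟩, d⟩; exact ⟨b, c, a⟩
    · rintro ⟨b, c, a⟩; exact ⟨a, ⟨b, c⟩, by rw [b, c]⟩
  have e2 : ent p (fun ω => ((W ω, X ω), φ (X ω) (W ω))) =
      ent p (fun ω => (W ω, X ω)) := by
    apply ent_congr
    intro ω ω'
    simp only [Prod.mk.injEq]
    constructor
    · rintro ⟨⟨b, c⟩, d⟩; exact ⟨b, c⟩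
    · rintro ⟨b, c⟩; exact ⟨⟨b, c⟩, by rw [b, c]⟩
  have e3 : ent p (fun ω => (φ (X ω) (W ω), Y ω)) = ent p (fun ω => (Y ω, φ (X ω) (W ω))) := by
    apply ent_congr
    intro ω ω'
    simp only [Prod.mk.injEq]
    exact and_comm
  simp only at h3
  linarith

/-- For local stochastic operations `X̄ = f(X,U_X)`, `Ȳ = g(Y,U_Y)`,
`Z̄ = h(Z,U_Z)` with fresh randomness `U_X, U_Y, U_Z` (mutually independent of each
other and of the triple `(X,Y,Z)`), we have
`I(X̄ : Ȳ | Z̄) ≤ I(X : Y | Z) + I((X,Y) : Z) − I((X,Y) : Z̄)`. -/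
theorem stmt_2 {Ω S T U A B C S' T' U' : Type*} [Fintype Ω]
    [Fintype S] [DecidableEq S] [Fintype T] [DecidableEq T] [Fintype U] [DecidableEq U]
    [Fintype A] [DecidableEq A] [Fintype B] [DecidableEq B] [Fintype C] [DecidableEq C]
    [Fintype S'] [DecidableEq S'] [Fintype T'] [DecidableEq T'] [Fintype U'] [DecidableEq U']
    (p : Ω → ℝ) (hp : ∀ ω, 0 ≤ p ω) (hp1 : ∑ ω, p ω = 1)
    (X : Ω → S) (Y : Ω → T) (Z : Ω → U)
    (UX : Ω → A) (UY : Ω → B) (UZ : Ω → C)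
    (f : S → A → S') (g : T → B → T') (h : U → C → U')
    (hind : ∀ (a : A) (b : B) (c : C) (v : S × T × U),
      pOf p (fun ω => (UX ω, UY ω, UZ ω, (X ω, Y ω, Z ω))) (a, b, c, v)
        = pOf p UX a * pOf p UY b * pOf p UZ c
            * pOf p (fun ω => (X ω, Y ω, Z ω)) v) :
    cmi p (fun ω => f (X ω) (UX ω)) (fun ω => g (Y ω) (UY ω)) (fun ω => h (Z ω) (UZ ω))
      ≤ cmi p X Y Z + mi p (fun ω => (X ω, Y ω)) Z
          - mi p (fun ω => (X ω, Y ω)) (fun ω => h (Z ω) (UZ ω)) := by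
  have iX : Ind p UX (fun ω => (UY ω, UZ ω, (X ω, Y ω, Z ω))) := by
    refine Ind.of_factor p hp1 _ _ (fun t => pOf p UY t.1 * pOf p UZ t.2.1
      * pOf p (fun ω => (X ω, Y ω, Z ω)) t.2.2) ?_
    rintro a ⟨b, c, v⟩
    rw [hind]; ring
  have iY : Ind p UY (fun ω => (UX ω, UZ ω, (X ω, Y ω, Z ω))) := by
    refine Ind.of_factor p hp1 _ _ (fun t => pOf p UX t.1 * pOf p UZ t.2.1
      * pOf p (fun ω => (X ω, Y ω, Z ω)) t.2.2) ?_
    rintro b ⟨a, c, v⟩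
    have := hind a b c v
    have e : pOf p (fun ω => (UY ω, UX ω, UZ ω, (X ω, Y ω, Z ω))) (b, a, c, v)
        = pOf p (fun ω => (UX ω, UY ω, UZ ω, (X ω, Y ω, Z ω))) (a, b, c, v) := by
      unfold pOf
      refine Finset.sum_congr rfl fun ω _ => if_congr ?_ rfl rfl
      simp only [Prod.mk.injEq]; tauto
    rw [e, this]; ring
  have iZ : Ind p UZ (fun ω => (UX ω, UY ω, (X ω, Y ω, Z ω))) := by
    refine Ind.of_factor p hp1 _ _ (fun t => pOf p UX t.1 * pOf p UY t.2.1
      * pOf p (fun ω => (X ω, Y ω, Z ω)) t.2.2) ?_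
    rintro c ⟨a, b, v⟩
    have := hind a b c v
    have e : pOf p (fun ω => (UZ ω, UX ω, UY ω, (X ω, Y ω, Z ω))) (c, a, b, v)
        = pOf p (fun ω => (UX ω, UY ω, UZ ω, (X ω, Y ω, Z ω))) (a, b, c, v) := by
      unfold pOf
      refine Finset.sum_congr rfl fun ω _ => if_congr ?_ rfl rfl
      simp only [Prod.mk.injEq]; tauto
    rw [e, this]; ring
  -- the four data processing steps
  have s1 := dataProc p hp hp1 (fun ω => (X ω, Z ω)) Y UZ (fun q c => (q.1, h q.2 c))
    (iZ.comp (fun t => ((t.2.2.1, t.2.2.2.2), t.2.2.2.1)))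
  have s2 := dataProc p hp hp1 (fun ω => (Y ω, Z ω)) X UZ (fun q c => (q.1, h q.2 c))
    (iZ.comp (fun t => ((t.2.2.2.1, t.2.2.2.2), t.2.2.1)))
  have s3 := dataProc p hp hp1 (fun ω => (X ω, h (Z ω) (UZ ω))) (fun ω => g (Y ω) (UY ω)) UX
    (fun q a => (f q.1 a, q.2))
    (iX.comp (fun t => ((t.2.2.1, h t.2.2.2.2 t.2.1), g t.2.2.2.1 t.1)))
  have s4 := dataProc p hp hp1 (fun ω => (Y ω, h (Z ω) (UZ ω))) X UY
    (fun q b => (g q.1 b, q.2))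
    (iY.comp (fun t => ((t.2.2.2.1, h t.2.2.2.2 t.2.1), t.2.2.1)))
  have e1 : ent p (fun ω => ((X ω, Z ω), Y ω)) = ent p (fun ω => ((X ω, Y ω), Z ω)) := by
    apply ent_congr; intro ω ω'; simp only [Prod.mk.injEq]; tauto
  have e2 : ent p (fun ω => ((Y ω, Z ω), X ω)) = ent p (fun ω => ((X ω, Y ω), Z ω)) := by
    apply ent_congr; intro ω ω'; simp only [Prod.mk.injEq]; tauto
  have e3 : ent p (fun ω => ((X ω, h (Z ω) (UZ ω)), Y ω))
      = ent p (fun ω => ((X ω, Y ω), h (Z ω) (UZ ω))) := by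
    apply ent_congr; intro ω ω'; simp only [Prod.mk.injEq]; tauto
  have e4 : ent p (fun ω => ((Y ω, h (Z ω) (UZ ω)), X ω))
      = ent p (fun ω => ((X ω, Y ω), h (Z ω) (UZ ω))) := by
    apply ent_congr; intro ω ω'; simp only [Prod.mk.injEq]; tauto
  have e5 : ent p (fun ω => ((X ω, h (Z ω) (UZ ω)), g (Y ω) (UY ω)))
      = ent p (fun ω => ((g (Y ω) (UY ω), h (Z ω) (UZ ω)), X ω)) := by
    apply ent_congr; intro ω ω'; simp only [Prod.mk.injEq]; tauto
  have e6 : ent p (fun ω => ((f (X ω) (UX ω), h (Z ω) (UZ ω)), g (Y ω) (UY ω)))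
      = ent p (fun ω => ((f (X ω) (UX ω), g (Y ω) (UY ω)), h (Z ω) (UZ ω))) := by
    apply ent_congr; intro ω ω'; simp only [Prod.mk.injEq]; tauto
  simp only at s1 s2 s3 s4
  unfold cmi mi
  linarith
end

section
/- Let N ≥ 3 and let X_1, …, X_N be random variables taking finitely many values. Suppose that for every pair of distinct indices i, j ∈ {1,…,N}, the variable X_i is independent of the random vector (X_k)_{k∉{i,j}}. Then for every index j, the family of variables (X_i)_{i≠j} is mutually (jointly) independent, i.e., the joint distribution of any N−1 of the variables is the product of its marginals. -/
open Classical in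
theorem pOf_sum_aux {Ω S : Type*} [Fintype Ω] [Fintype S] [DecidableEq S]
    (p : Ω → ℝ) (Y : Ω → S) (Q : S → Prop) :
    ∑ y, (if Q y then pOf p Y y else 0) = ∑ ω, if Q (Y ω) then p ω else 0 := by
  have h : ∀ y, (if Q y then pOf p Y y else 0)
      = ∑ ω, if Y ω = y then (if Q y then p ω else 0) else 0 := by
    intro y
    unfold pOf
    split_ifs <;> simp
  simp_rw [h]
  rw [Finset.sum_comm]
  refine Finset.sum_congr rfl fun ω _ => ?_
  simp

/-- for `N = M + 3 ≥ 3` random variables, if for every pair of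
distinct indices `i ≠ j` the variable `X_i` is independent of the random vector
`(X_k)_{k ∉ {i,j}}`, then for every index `j` the family `(X_i)_{i ≠ j}` is
mutually (jointly) independent: the joint distribution of any `N − 1` of the
variables is the product of its marginals. -/
theorem stmt_6 {M : ℕ} {Ω : Type*} [Fintype Ω]
    {V : Fin (M + 3) → Type*} [∀ i, Fintype (V i)] [∀ i, DecidableEq (V i)]
    (p : Ω → ℝ) (hp : ∀ ω, 0 ≤ p ω) (hp1 : ∑ ω, p ω = 1)
    (X : (i : Fin (M + 3)) → Ω → V i)
    (hind : ∀ (i j : Fin (M + 3)), i ≠ j →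
      ∀ (a : V i) (y : (k : {k : Fin (M + 3) // k ≠ i ∧ k ≠ j}) → V k),
        pOf p (fun ω => (X i ω, fun k : {k : Fin (M + 3) // k ≠ i ∧ k ≠ j} => X k ω)) (a, y)
          = pOf p (X i) a
              * pOf p (fun ω => fun k : {k : Fin (M + 3) // k ≠ i ∧ k ≠ j} => X k ω) y) :
    ∀ (j : Fin (M + 3)) (x : (i : {i : Fin (M + 3) // i ≠ j}) → V i),
      pOf p (fun ω => fun i : {i : Fin (M + 3) // i ≠ j} => X i ω) x
        = ∏ i : {i : Fin (M + 3) // i ≠ j}, pOf p (X i) (x i) := by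
  classical
  intro j x
  have hne : Nonempty Ω := by
    by_contra h
    rw [not_nonempty_iff] at h
    simp at hp1
  obtain ⟨ω₀⟩ := hne
  let z : ∀ k, V k := fun k => if h : k ≠ j then x ⟨k, h⟩ else X k ω₀
  have hz : ∀ k : {i : Fin (M + 3) // i ≠ j}, z k = x k := by
    intro k
    simp only [z]
    rw [dif_pos k.2]
  have key : ∀ A : Finset (Fin (M + 3)), j ∉ A →
      (∑ ω, if (∀ k ∈ A, X k ω = z k) then p ω else 0) = ∏ k ∈ A, pOf p (X k) (z k) := by
    intro A
    induction A using Finset.induction_on with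
    | empty => intro _; simpa using hp1
    | insert i A hi ih =>
      intro hj
      have hij : i ≠ j := fun h => hj (by simp [h])
      have hjA : j ∉ A := fun h => hj (by simp [h])
      rw [Finset.prod_insert hi, ← ih hjA]
      have e2 := pOf_sum_aux p (fun ω => fun k : {k : Fin (M + 3) // k ≠ i ∧ k ≠ j} => X k ω)
        (fun y => ∀ k : {k : Fin (M + 3) // k ≠ i ∧ k ≠ j}, (k : Fin (M + 3)) ∈ A → y k = z k)
      have e1 := pOf_sum_aux p
        (fun ω => (X i ω, fun k : {k : Fin (M + 3) // k ≠ i ∧ k ≠ j} => X k ω))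
        (fun y => y.1 = z i ∧ ∀ k : {k : Fin (M + 3) // k ≠ i ∧ k ≠ j},
          (k : Fin (M + 3)) ∈ A → y.2 k = z k)
      have c : ∀ ω, (∀ k : {k : Fin (M + 3) // k ≠ i ∧ k ≠ j},
          (k : Fin (M + 3)) ∈ A → X k ω = z k) ↔ ∀ k ∈ A, X k ω = z k := by
        intro ω
        constructor
        · intro h k hk
          exact h ⟨k, fun h' => hi (h' ▸ hk), fun h' => hjA (h' ▸ hk)⟩ hk
        · intro h k hk
          exact h k hk
      simp only [c] at e1 e2
      simp only [Finset.forall_mem_insert]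
      rw [← e1, ← e2, Fintype.sum_prod_type, Finset.sum_eq_single (z i)]
      · rw [Finset.mul_sum]
        refine Finset.sum_congr rfl fun y _ => ?_
        rw [hind i j hij]
        simp
      · intro b _ hb
        simp [hb]
      · simp
  have hf := key (Finset.univ.filter (fun k => k ≠ j)) (by simp)
  rw [Finset.prod_subtype (p := fun k => k ≠ j) _ (by simp)] at hf
  simp only [hz] at hf
  rw [← hf]
  unfold pOf
  refine Finset.sum_congr rfl fun ω _ => ?_
  refine if_congr ?_ rfl rfl
  rw [funext_iff]
  constructor
  · intro h k hk
    have hk' : k ≠ j := by simpa using hk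
    exact (h ⟨k, hk'⟩).trans (hz ⟨k, hk'⟩).symm
  · intro h k
    exact (h k (by simpa using k.2)).trans (hz k)
end

section
/- Let (X_1,X_2,X_3) be a random vector on {0,1}³ with distribution P(0,0,0)=1/2, P(1,0,1)=1/8, P(1,1,0)=1/8, P(1,1,1)=1/4, and let (Y_1,Y_2,Y_3) be the random vector on {0,1}³ with distribution Q(0,0,0)=1/2, Q(0,0,1)=1/16, Q(0,1,0)=1/16, Q(0,1,1)=1/8, Q(1,0,1)=1/16, Q(1,1,0)=1/16, Q(1,1,1)=1/8 (obtained from P by the local stochastic operation that flips the first bit from 1 to 0 with probability 1/2). Then the tripartite dependence strictly increases: min{ I(Y_1:Y_2|Y_3), I(Y_1:Y_3|Y_2), I(Y_2:Y_3|Y_1) } > min{ I(X_1:X_2|X_3), I(X_1:X_3|X_2), I(X_2:X_3|X_1) }. Hence the tripartite dependence is not monotone under local operations. -/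
/-- The distribution `P` on `{0,1}³` with
`P(0,0,0)=1/2, P(1,0,1)=1/8, P(1,1,0)=1/8, P(1,1,1)=1/4` (0 = `false`, 1 = `true`). -/
noncomputable def P8 : Bool × Bool × Bool → ℝ := fun x =>
  if x = (false, false, false) then 1 / 2
  else if x = (true, false, true) then 1 / 8
  else if x = (true, true, false) then 1 / 8
  else if x = (true, true, true) then 1 / 4
  else 0

/-- The distribution `Q` on `{0,1}³` obtained from `P8` by flipping the first bit
from 1 to 0 with probability 1/2:
`Q(0,0,0)=1/2, Q(0,0,1)=1/16, Q(0,1,0)=1/16, Q(0,1,1)=1/8, Q(1,0,1)=1/16,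
Q(1,1,0)=1/16, Q(1,1,1)=1/8`. -/
noncomputable def Q8 : Bool × Bool × Bool → ℝ := fun x =>
  if x = (false, false, false) then 1 / 2
  else if x = (false, false, true) then 1 / 16
  else if x = (false, true, false) then 1 / 16
  else if x = (false, true, true) then 1 / 8
  else if x = (true, false, true) then 1 / 16
  else if x = (true, true, false) then 1 / 16
  else if x = (true, true, true) then 1 / 8
  else 0

/-- First bit. -/
def B1 : Bool × Bool × Bool → Bool := fun x => x.1
/-- Second bit. -/
def B2 : Bool × Bool × Bool → Bool := fun x => x.2.1
/-- Third bit. -/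
def B3 : Bool × Bool × Bool → Bool := fun x => x.2.2


lemma aux_nml (k m : ℝ) (hk : 0 < k) (hm : 0 < m) :
    Real.negMulLog (k / m) = k / m * (Real.log m - Real.log k) := by
  rw [Real.negMulLog, Real.log_div hk.ne' hm.ne']; ring

lemma aux4 : Real.log 4 = 2 * Real.log 2 := by
  rw [show (4:ℝ) = 2 ^ 2 by norm_num, Real.log_pow]; norm_num

lemma aux8 : Real.log 8 = 3 * Real.log 2 := by
  rw [show (8:ℝ) = 2 ^ 3 by norm_num, Real.log_pow]; norm_num

lemma aux16 : Real.log 16 = 4 * Real.log 2 := by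
  rw [show (16:ℝ) = 2 ^ 4 by norm_num, Real.log_pow]; norm_num

lemma n0 : Real.negMulLog (1/2) = Real.log 2 / 2 := by
  rw [aux_nml _ _ (by norm_num) (by norm_num), Real.log_one]; ring
lemma n1 : Real.negMulLog (1/4) = Real.log 2 / 2 := by
  rw [aux_nml _ _ (by norm_num) (by norm_num), Real.log_one, aux4]; ring
lemma n2 : Real.negMulLog (1/8) = 3 * Real.log 2 / 8 := by
  rw [aux_nml _ _ (by norm_num) (by norm_num), Real.log_one, aux8]; ring
lemma n3 : Real.negMulLog (1/16) = Real.log 2 / 4 := by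
  rw [aux_nml _ _ (by norm_num) (by norm_num), Real.log_one, aux16]; ring
lemma n4 : Real.negMulLog (3/4) = 3/4 * (2 * Real.log 2 - Real.log 3) := by
  rw [aux_nml _ _ (by norm_num) (by norm_num), aux4]
lemma n5 : Real.negMulLog (3/8) = 3/8 * (3 * Real.log 2 - Real.log 3) := by
  rw [aux_nml _ _ (by norm_num) (by norm_num), aux8]
lemma n6 : Real.negMulLog (5/8) = 5/8 * (3 * Real.log 2 - Real.log 5) := by
  rw [aux_nml _ _ (by norm_num) (by norm_num), aux8]
lemma n7 : Real.negMulLog (3/16) = 3/16 * (4 * Real.log 2 - Real.log 3) := by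
  rw [aux_nml _ _ (by norm_num) (by norm_num), aux16]
lemma n8 : Real.negMulLog (9/16) = 9/16 * (4 * Real.log 2 - 2 * Real.log 3) := by
  rw [aux_nml _ _ (by norm_num) (by norm_num), aux16,
    show (9:ℝ) = 3 ^ 2 by norm_num, Real.log_pow]; norm_num

lemma cP : cmi P8 B2 B3 B1 = 5/4 * Real.log 2 - 3/4 * Real.log 3 := by
  simp [cmi, ent, pOf, P8, B1, B2, B3, Fintype.sum_prod_type, -one_div]
  norm_num [n0, n1, n2, n3, n4, n5, n6, n7, n8, -one_div]
  ring_nf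

lemma cQ1 : cmi Q8 B1 B2 B3 =
    Real.log 2 * (1 / 2) + Real.log 3 * (-9 / 8) + Real.log 5 * (5 / 8) := by
  simp [cmi, ent, pOf, Q8, B1, B2, B3, Fintype.sum_prod_type, -one_div]
  norm_num [n0, n1, n2, n3, n4, n5, n6, n7, n8, -one_div]
  ring_nf

lemma cQ2 : cmi Q8 B1 B3 B2 =
    Real.log 2 * (1 / 2) + Real.log 3 * (-9 / 8) + Real.log 5 * (5 / 8) := by
  simp [cmi, ent, pOf, Q8, B1, B2, B3, Fintype.sum_prod_type, -one_div]
  norm_num [n0, n1, n2, n3, n4, n5, n6, n7, n8, -one_div]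
  ring_nf

lemma cQ3 : cmi Q8 B2 B3 B1 = Real.log 2 * (15 / 4) + Real.log 3 * (-9 / 4) := by
  simp [cmi, ent, pOf, Q8, B1, B2, B3, Fintype.sum_prod_type, -one_div]
  norm_num [n0, n1, n2, n3, n4, n5, n6, n7, n8, -one_div]
  ring_nf

lemma ineq1 : 6 * Real.log 2 + 3 * Real.log 3 < 5 * Real.log 5 := by
  have h : Real.log ((2:ℝ) ^ 6 * 3 ^ 3) < Real.log ((5:ℝ) ^ 5) :=
    Real.log_lt_log (by norm_num) (by norm_num)
  rw [Real.log_mul (by norm_num) (by norm_num), Real.log_pow, Real.log_pow, Real.log_pow] at h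
  exact_mod_cast h

lemma ineq2 : 3 * Real.log 3 < 5 * Real.log 2 := by
  have h : Real.log ((3:ℝ) ^ 3) < Real.log ((2:ℝ) ^ 5) :=
    Real.log_lt_log (by norm_num) (by norm_num)
  rw [Real.log_pow, Real.log_pow] at h
  exact_mod_cast h

/-- the tripartite dependence strictly increases under the local
stochastic operation taking `(X_1,X_2,X_3) ~ P8` to `(Y_1,Y_2,Y_3) ~ Q8`;
hence the tripartite dependence is not monotone under local operations. -/
theorem stmt_8 :
    min (min (cmi P8 B1 B2 B3) (cmi P8 B1 B3 B2)) (cmi P8 B2 B3 B1)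
      < min (min (cmi Q8 B1 B2 B3) (cmi Q8 B1 B3 B2)) (cmi Q8 B2 B3 B1) := by
  refine lt_of_le_of_lt (min_le_right _ _) ?_
  rw [cP, cQ1, cQ2, cQ3]
  have h1 := ineq1
  have h2 := ineq2
  refine lt_min (lt_min ?_ ?_) ?_ <;> linarith
end

section
/- For every tripartite density matrix ρ on parties A, B, C with finite local dimensions, the quantum mutual informations obey the monogamy relation I(A:B) + I(B:C) ≤ 2 S(ρ_B), where ρ_B is the marginal on party B. -/
open Matrix ComplexOrder

/-- Von Neumann entropy `S(ρ) = −Σ_i λ_i log λ_i` (natural logarithm, `0 log 0 = 0`),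
where `λ_i` are the eigenvalues of the (Hermitian) matrix `ρ`; junk value `0` for
non-Hermitian matrices. -/
noncomputable def vNEntropy {n : Type*} [Fintype n] [DecidableEq n]
    (ρ : Matrix n n ℂ) : ℝ :=
  if h : ρ.IsHermitian then ∑ i, Real.negMulLog (h.eigenvalues i) else 0

/-- The configuration on `Fin N` agreeing with `a` off `T` and with `c` on `T`. -/
def mergeOn {N d : ℕ} (T : Finset (Fin N)) (a : {i : Fin N // i ∉ T} → Fin d)
    (c : {i : Fin N // i ∈ T} → Fin d) : Fin N → Fin d :=
  fun i => if h : i ∈ T then c ⟨i, h⟩ else a ⟨i, h⟩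

/-- Partial trace over the set `T` of parties:
`(Tr_T ρ)_{a,b} = Σ_c ρ_{(a⊔c),(b⊔c)}` with `c` running over configurations on `T`. -/
noncomputable def ptrace {N d : ℕ} (T : Finset (Fin N))
    (ρ : Matrix (Fin N → Fin d) (Fin N → Fin d) ℂ) :
    Matrix ({i : Fin N // i ∉ T} → Fin d) ({i : Fin N // i ∉ T} → Fin d) ℂ :=
  Matrix.of fun a b => ∑ c : {i : Fin N // i ∈ T} → Fin d,
    ρ (mergeOn T a c) (mergeOn T b c)

/-- `N`-partite dependence of an `N`-partite density matrix of local dimension `d`: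
the minimum over pairs of distinct indices `i ≠ j` of
`S(Tr_{{i}} ρ) + S(Tr_{{j}} ρ) − S(Tr_{{i,j}} ρ) − S(ρ)` (as an infimum of the
finite nonempty set of such values). -/
noncomputable def depQ {N d : ℕ} (ρ : Matrix (Fin N → Fin d) (Fin N → Fin d) ℂ) : ℝ :=
  sInf {x | ∃ i j : Fin N, i ≠ j ∧
    x = vNEntropy (ptrace {i} ρ) + vNEntropy (ptrace {j} ρ)
        - vNEntropy (ptrace {i, j} ρ) - vNEntropy ρ}

/-- Marginal on party `A` of a tripartite matrix. -/
noncomputable def margA {dA dB dC : ℕ}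
    (ρ : Matrix (Fin dA × Fin dB × Fin dC) (Fin dA × Fin dB × Fin dC) ℂ) :
    Matrix (Fin dA) (Fin dA) ℂ :=
  Matrix.of fun a a' => ∑ b : Fin dB, ∑ c : Fin dC, ρ (a, b, c) (a', b, c)

/-- Marginal on party `B` of a tripartite matrix. -/
noncomputable def margB {dA dB dC : ℕ}
    (ρ : Matrix (Fin dA × Fin dB × Fin dC) (Fin dA × Fin dB × Fin dC) ℂ) :
    Matrix (Fin dB) (Fin dB) ℂ :=
  Matrix.of fun b b' => ∑ a : Fin dA, ∑ c : Fin dC, ρ (a, b, c) (a, b', c)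

/-- Marginal on party `C` of a tripartite matrix. -/
noncomputable def margC {dA dB dC : ℕ}
    (ρ : Matrix (Fin dA × Fin dB × Fin dC) (Fin dA × Fin dB × Fin dC) ℂ) :
    Matrix (Fin dC) (Fin dC) ℂ :=
  Matrix.of fun c c' => ∑ a : Fin dA, ∑ b : Fin dB, ρ (a, b, c) (a, b, c')

/-- Marginal on parties `A, B` of a tripartite matrix. -/
noncomputable def margAB {dA dB dC : ℕ}
    (ρ : Matrix (Fin dA × Fin dB × Fin dC) (Fin dA × Fin dB × Fin dC) ℂ) :
    Matrix (Fin dA × Fin dB) (Fin dA × Fin dB) ℂ :=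
  Matrix.of fun x y => ∑ c : Fin dC, ρ (x.1, x.2, c) (y.1, y.2, c)

/-- Marginal on parties `B, C` of a tripartite matrix. -/
noncomputable def margBC {dA dB dC : ℕ}
    (ρ : Matrix (Fin dA × Fin dB × Fin dC) (Fin dA × Fin dB × Fin dC) ℂ) :
    Matrix (Fin dB × Fin dC) (Fin dB × Fin dC) ℂ :=
  Matrix.of fun x y => ∑ a : Fin dA, ρ (a, x.1, x.2) (a, y.1, y.2)

/-- `X = U diag(p) U†` with `U` unitary. -/
def IsD {n : Type*} [Fintype n] [DecidableEq n] (U : Matrix n n ℂ) (p : n → ℝ)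
    (X : Matrix n n ℂ) : Prop :=
  X = U * diagonal (fun i => (p i : ℂ)) * Uᴴ ∧ Uᴴ * U = 1

section
variable {n : Type*} [Fintype n] [DecidableEq n]

lemma exists_isD {X : Matrix n n ℂ} (h : X.IsHermitian) : ∃ U, IsD U h.eigenvalues X := by
  refine ⟨(h.eigenvectorUnitary : Matrix n n ℂ), ?_, ?_⟩
  · have := h.spectral_theorem
    rw [Unitary.conjStarAlgAut_apply] at this
    exact this
  · have := Unitary.coe_star_mul_self h.eigenvectorUnitary
    exact this

lemma IsD.herm {U : Matrix n n ℂ} {p : n → ℝ} {X : Matrix n n ℂ} (h : IsD U p X) :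
    X.IsHermitian := by
  rw [h.1]
  apply isHermitian_mul_mul_conjTranspose
  simp [Matrix.IsHermitian, diagonal_conjTranspose]

lemma vN_roots {X : Matrix n n ℂ} (h : X.IsHermitian) :
    vNEntropy X = (X.charpoly.roots.map (fun z => Real.negMulLog z.re)).sum := by
  rw [vNEntropy, dif_pos h, h.roots_charpoly_eq_eigenvalues, Multiset.map_map]
  simp

lemma IsD.vN {U : Matrix n n ℂ} {p : n → ℝ} {X : Matrix n n ℂ} (h : IsD U p X) :
    vNEntropy X = ∑ i, Real.negMulLog (p i) := by
  rw [vN_roots h.herm, h.1, charpoly_mul_comm, ← mul_assoc, h.2, one_mul, charpoly_diagonal,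
    Polynomial.roots_prod _ _ (by simp [Finset.prod_ne_zero_iff, Polynomial.X_sub_C_ne_zero])]
  simp

lemma IsD.add_smul_one {U : Matrix n n ℂ} {p : n → ℝ} {X : Matrix n n ℂ} (h : IsD U p X)
    (t : ℝ) : IsD U (fun i => p i + t) (X + (t : ℂ) • 1) := by
  refine ⟨?_, h.2⟩
  have e : (diagonal (fun i => ((p i + t : ℝ) : ℂ)) : Matrix n n ℂ)
      = diagonal (fun i => (p i : ℂ)) + (t : ℂ) • 1 := by
    ext i j; by_cases hij : i = j <;> simp [hij, diagonal]
  rw [e, mul_add, add_mul, ← h.1]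
  simp [mul_eq_one_comm.1 h.2]

lemma vN_tendsto {X : Matrix n n ℂ} (h : X.IsHermitian) (c : ℝ) :
    Filter.Tendsto (fun t : ℝ => vNEntropy (X + ((c * t : ℝ) : ℂ) • 1))
      (nhdsWithin 0 (Set.Ioi 0)) (nhds (vNEntropy X)) := by
  obtain ⟨U, hU⟩ := exists_isD h
  have e : (fun t : ℝ => vNEntropy (X + ((c * t : ℝ) : ℂ) • 1))
      = fun t => ∑ i, Real.negMulLog (h.eigenvalues i + c * t) := by
    funext t; exact (hU.add_smul_one (c * t)).vN
  rw [e, hU.vN]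
  have hc : Continuous fun t : ℝ => ∑ i, Real.negMulLog (h.eigenvalues i + c * t) :=
    continuous_finsetSum _ fun i _ => Real.continuous_negMulLog.comp (by fun_prop)
  have := hc.tendsto 0
  simp only [mul_zero, add_zero] at this
  exact this.mono_left nhdsWithin_le_nhds

lemma vN_reindex {m : Type*} [Fintype m] [DecidableEq m] {X : Matrix n n ℂ} (h : X.IsHermitian)
    (e : n ≃ m) : vNEntropy (X.submatrix e.symm e.symm) = vNEntropy X := by
  rw [vN_roots h, vN_roots (h.submatrix _)]
  have := charpoly_reindex e X
  rw [reindex_apply] at this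
  rw [this]

lemma vN_schmidt {m : Type*} [Fintype m] [DecidableEq m] (M : Matrix n m ℂ) :
    vNEntropy (M * Mᴴ) = vNEntropy (Mᵀ * Mᵀᴴ) := by
  rw [vN_roots (isHermitian_mul_conjTranspose_self _),
    vN_roots (isHermitian_mul_conjTranspose_self _)]
  have e : Mᵀ * Mᵀᴴ = (Mᴴ * M)ᵀ := by
    rw [transpose_mul]; rfl
  rw [e, charpoly_transpose]
  have h := congrArg (fun P : Polynomial ℂ => (P.roots.map (fun z => Real.negMulLog z.re)).sum)
    (charpoly_mul_comm' M Mᴴ)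
  rw [Polynomial.roots_mul, Polynomial.roots_mul] at h
  · simpa [Multiset.map_nsmul, Multiset.sum_nsmul] using h
  · exact mul_ne_zero (pow_ne_zero _ Polynomial.X_ne_zero) (charpoly_monic _).ne_zero
  · exact mul_ne_zero (pow_ne_zero _ Polynomial.X_ne_zero) (charpoly_monic _).ne_zero

/-- The linear functional in the variational formula. -/
noncomputable def Lf (u : ℝ) (Y ρ σ : Matrix n n ℂ) : ℝ :=
  2 * ((Yᴴ * σ).trace.re - (Yᴴ * ρ).trace.re) - (1 - u) * (Y * σ * Yᴴ).trace.re
    - u * (Yᴴ * ρ * Y).trace.re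

lemma Lf_add (u : ℝ) (Y ρ σ ρ' σ' : Matrix n n ℂ) :
    Lf u Y (ρ + ρ') (σ + σ') = Lf u Y ρ σ + Lf u Y ρ' σ' := by
  simp only [Lf, mul_add, add_mul, trace_add, Complex.add_re]; ring

lemma Lf_eq {U V : Matrix n n ℂ} {p q : n → ℝ} {ρ σ : Matrix n n ℂ} (hρ : IsD U p ρ)
    (hσ : IsD V q σ) (u : ℝ) (Z : Matrix n n ℂ) :
    Lf u (U * Z * Vᴴ) ρ σ = ∑ i, ∑ j,
      (2 * (star (Z i j) * (Uᴴ * V) i j).re * (q j - p i)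
        - Complex.normSq (Z i j) * ((1 - u) * q j + u * p i)) := by
  have hU := hρ.2
  have hV := hσ.2
  have hY : (U * Z * Vᴴ)ᴴ = V * Zᴴ * Uᴴ := by simp [mul_assoc]
  have e1 : ((U * Z * Vᴴ)ᴴ * σ).trace = (Zᴴ * ((Uᴴ * V) * diagonal (fun i => (q i : ℂ)))).trace := by
    rw [hY, hσ.1]
    calc _ = (V * (Zᴴ * Uᴴ * V * diagonal (fun i => (q i : ℂ)) * Vᴴ)).trace := by
            simp only [mul_assoc]
      _ = _ := by rw [trace_mul_comm]; simp only [mul_assoc, hV, mul_one]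
  have e2 : ((U * Z * Vᴴ)ᴴ * ρ).trace = (Zᴴ * (diagonal (fun i => (p i : ℂ)) * (Uᴴ * V))).trace := by
    rw [hY, hρ.1]
    calc _ = (V * (Zᴴ * (Uᴴ * U) * diagonal (fun i => (p i : ℂ)) * Uᴴ)).trace := by
            simp only [mul_assoc]
      _ = _ := by rw [trace_mul_comm]; simp only [mul_assoc, hU, one_mul]
  have e3 : ((U * Z * Vᴴ) * σ * (U * Z * Vᴴ)ᴴ).trace
      = (Z * (diagonal (fun i => (q i : ℂ)) * Zᴴ)).trace := by
    rw [hY, hσ.1]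
    calc _ = (U * (Z * (Vᴴ * V) * diagonal (fun i => (q i : ℂ)) * (Vᴴ * V) * Zᴴ * Uᴴ)).trace := by
            simp only [mul_assoc]
      _ = _ := by rw [trace_mul_comm]; simp only [mul_assoc, hV, hU, mul_one, one_mul]
  have e4 : ((U * Z * Vᴴ)ᴴ * ρ * (U * Z * Vᴴ)).trace
      = (Zᴴ * (diagonal (fun i => (p i : ℂ)) * Z)).trace := by
    rw [hY, hρ.1]
    calc _ = (V * (Zᴴ * (Uᴴ * U) * diagonal (fun i => (p i : ℂ)) * (Uᴴ * U) * Z * Vᴴ)).trace := by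
            simp only [mul_assoc]
      _ = _ := by rw [trace_mul_comm]; simp only [mul_assoc, hV, hU, mul_one, one_mul]
  rw [Lf, e1, e2, e3, e4]
  generalize Uᴴ * V = T
  have f1 : (Zᴴ * (T * diagonal (fun i => (q i : ℂ)))).trace.re
      = ∑ i, ∑ j, (star (Z i j) * T i j).re * q j := by
    rw [Finset.sum_comm]
    simp only [trace, diag, Matrix.mul_apply (M := Zᴴ), mul_diagonal, conjTranspose_apply,
      Complex.re_sum]
    refine Finset.sum_congr rfl fun i _ => Finset.sum_congr rfl fun j _ => ?_
    rw [← mul_assoc, Complex.re_mul_ofReal]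
  have f2 : (Zᴴ * (diagonal (fun i => (p i : ℂ)) * T)).trace.re
      = ∑ i, ∑ j, (star (Z i j) * T i j).re * p i := by
    rw [Finset.sum_comm]
    simp only [trace, diag, Matrix.mul_apply (M := Zᴴ), diagonal_mul, conjTranspose_apply,
      Complex.re_sum]
    refine Finset.sum_congr rfl fun i _ => Finset.sum_congr rfl fun j _ => ?_
    rw [mul_left_comm, Complex.re_ofReal_mul, mul_comm]
  have f3 : (Z * (diagonal (fun i => (q i : ℂ)) * Zᴴ)).trace.re
      = ∑ i, ∑ j, Complex.normSq (Z i j) * q j := by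
    simp only [trace, diag, Matrix.mul_apply (M := Z), diagonal_mul, conjTranspose_apply,
      Complex.re_sum]
    refine Finset.sum_congr rfl fun i _ => Finset.sum_congr rfl fun j _ => ?_
    rw [mul_left_comm, Complex.re_ofReal_mul, mul_comm]
    congr 1
    simp [Complex.normSq_apply]
  have f4 : (Zᴴ * (diagonal (fun i => (p i : ℂ)) * Z)).trace.re
      = ∑ i, ∑ j, Complex.normSq (Z i j) * p i := by
    rw [Finset.sum_comm]
    simp only [trace, diag, Matrix.mul_apply (M := Zᴴ), diagonal_mul, conjTranspose_apply,
      Complex.re_sum]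
    refine Finset.sum_congr rfl fun i _ => Finset.sum_congr rfl fun j _ => ?_
    rw [mul_left_comm, Complex.re_ofReal_mul, mul_comm]
    congr 1
    simp [Complex.normSq_apply]
  rw [f1, f2, f3, f4]
  simp only [← Finset.sum_sub_distrib, Finset.mul_sum]
  refine Finset.sum_congr rfl fun i _ => Finset.sum_congr rfl fun j _ => ?_
  ring

/-- The quadratic form `⟨σ-ρ, ((1-u) L_σ + u R_ρ)⁻¹ (σ-ρ)⟩`. -/
noncomputable def Qf (U V : Matrix n n ℂ) (p q : n → ℝ) (u : ℝ) : ℝ :=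
  ∑ i, ∑ j, Complex.normSq ((Uᴴ * V) i j) * ((q j - p i) ^ 2 / ((1 - u) * q j + u * p i))

lemma conv_pos {p q u : ℝ} (hp : 0 < p) (hq : 0 < q) (h0 : 0 ≤ u) (h1 : u ≤ 1) :
    0 < (1 - u) * q + u * p := by
  rcases h0.eq_or_lt with rfl | h
  · simpa
  · have := mul_pos h hp
    have := mul_nonneg (sub_nonneg.2 h1) hq.le
    linarith

lemma Lf_le_Qf {U V : Matrix n n ℂ} {p q : n → ℝ} {ρ σ : Matrix n n ℂ} (hρ : IsD U p ρ)
    (hσ : IsD V q σ) (hp : ∀ i, 0 < p i) (hq : ∀ i, 0 < q i) {u : ℝ} (h0 : 0 ≤ u) (h1 : u ≤ 1)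
    (Y : Matrix n n ℂ) : Lf u Y ρ σ ≤ Qf U V p q u := by
  have hY : Y = U * (Uᴴ * Y * V) * Vᴴ := by
    calc Y = (U * Uᴴ) * Y * (V * Vᴴ) := by
          rw [mul_eq_one_comm.1 hρ.2, mul_eq_one_comm.1 hσ.2]; simp
      _ = _ := by simp only [mul_assoc]
  rw [hY, Lf_eq hρ hσ]
  generalize Uᴴ * Y * V = Z
  refine Finset.sum_le_sum fun i _ => Finset.sum_le_sum fun j _ => ?_
  have hr := conv_pos (hp i) (hq j) h0 h1
  generalize (1 - u) * q j + u * p i = r at *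
  rw [mul_div_assoc', le_div_iff₀ hr]
  simp only [Complex.normSq_apply, Complex.mul_re, Complex.star_def, Complex.conj_re,
    Complex.conj_im]
  generalize (Uᴴ * V) i j = t
  generalize Z i j = z
  nlinarith [sq_nonneg (t.re * (q j - p i) - z.re * r), sq_nonneg (t.im * (q j - p i) - z.im * r)]

lemma exists_Lf_eq_Qf {U V : Matrix n n ℂ} {p q : n → ℝ} {ρ σ : Matrix n n ℂ} (hρ : IsD U p ρ)
    (hσ : IsD V q σ) (hp : ∀ i, 0 < p i) (hq : ∀ i, 0 < q i) {u : ℝ} (h0 : 0 ≤ u) (h1 : u ≤ 1) :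
    ∃ Y, Lf u Y ρ σ = Qf U V p q u := by
  refine ⟨U * (Matrix.of fun i j => (((q j - p i) / ((1 - u) * q j + u * p i) : ℝ) : ℂ)
    * (Uᴴ * V) i j) * Vᴴ, ?_⟩
  rw [Lf_eq hρ hσ]
  refine Finset.sum_congr rfl fun i _ => Finset.sum_congr rfl fun j _ => ?_
  have hr := (conv_pos (hp i) (hq j) h0 h1).ne'
  simp only [of_apply]
  generalize (1 - u) * q j + u * p i = r at *
  generalize (Uᴴ * V) i j = t
  simp only [Complex.normSq_apply, Complex.mul_re, Complex.mul_im, Complex.star_def, map_mul,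
    Complex.conj_re, Complex.conj_im, Complex.conj_ofReal, Complex.ofReal_re, Complex.ofReal_im]
  field_simp
  ring

lemma Qf_add {U V U₁ V₁ U₂ V₂ : Matrix n n ℂ} {p q p₁ q₁ p₂ q₂ : n → ℝ}
    {ρ₁ σ₁ ρ₂ σ₂ : Matrix n n ℂ} (hρ : IsD U p (ρ₁ + ρ₂)) (hσ : IsD V q (σ₁ + σ₂))
    (hρ₁ : IsD U₁ p₁ ρ₁) (hσ₁ : IsD V₁ q₁ σ₁) (hρ₂ : IsD U₂ p₂ ρ₂) (hσ₂ : IsD V₂ q₂ σ₂)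
    (hp : ∀ i, 0 < p i) (hq : ∀ i, 0 < q i)
    (hp₁ : ∀ i, 0 < p₁ i) (hq₁ : ∀ i, 0 < q₁ i)
    (hp₂ : ∀ i, 0 < p₂ i) (hq₂ : ∀ i, 0 < q₂ i) {u : ℝ} (h0 : 0 ≤ u) (h1 : u ≤ 1) :
    Qf U V p q u ≤ Qf U₁ V₁ p₁ q₁ u + Qf U₂ V₂ p₂ q₂ u := by
  obtain ⟨Y, hY⟩ := exists_Lf_eq_Qf hρ hσ hp hq h0 h1
  rw [← hY, Lf_add]
  exact add_le_add (Lf_le_Qf hρ₁ hσ₁ hp₁ hq₁ h0 h1 Y) (Lf_le_Qf hρ₂ hσ₂ hp₂ hq₂ h0 h1 Y)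

lemma scalar_hasDeriv {p q : ℝ} (hp : 0 < p) (hq : 0 < q) {u : ℝ} (h0 : 0 ≤ u) (h1 : u ≤ 1) :
    HasDerivAt (fun u : ℝ => p * Real.log ((1 - u) * q + u * p) - (p - q) * u)
      ((1 - u) * ((q - p) ^ 2 / ((1 - u) * q + u * p))) u := by
  have hr := (conv_pos hp hq h0 h1).ne'
  have h : HasDerivAt (fun u : ℝ => (1 - u) * q + u * p) (p - q) u := by
    have := (((hasDerivAt_id u).const_sub 1).mul_const q).add ((hasDerivAt_id u).mul_const p)
    exact this.congr_deriv (by ring)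
  have := ((h.log hr).const_mul p).sub ((hasDerivAt_id u).const_mul (p - q))
  refine this.congr_deriv ?_
  obtain ⟨r, hr'⟩ : ∃ r, r = (1 - u) * q + u * p := ⟨_, rfl⟩
  rw [← hr'] at hr ⊢
  field_simp
  rw [hr']
  ring

lemma Qf_cont {U V : Matrix n n ℂ} {p q : n → ℝ}
    (hp : ∀ i, 0 < p i) (hq : ∀ i, 0 < q i) :
    ContinuousOn (fun u => (1 - u) * Qf U V p q u) (Set.uIcc 0 1) := by
  rw [Set.uIcc_of_le zero_le_one]
  unfold Qf
  refine ContinuousOn.mul (by fun_prop) ?_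
  refine continuousOn_finsetSum _ fun i _ => continuousOn_finsetSum _ fun j _ => ?_
  refine ContinuousOn.mul (by fun_prop) (ContinuousOn.div (by fun_prop) (by fun_prop) ?_)
  intro u hu
  exact (conv_pos (hp i) (hq j) hu.1 hu.2).ne'

lemma Qf_int {U V : Matrix n n ℂ} {p q : n → ℝ}
    (hp : ∀ i, 0 < p i) (hq : ∀ i, 0 < q i) :
    ∫ u in (0:ℝ)..1, (1 - u) * Qf U V p q u = ∑ i, ∑ j, Complex.normSq ((Uᴴ * V) i j) *
      (p i * Real.log (p i) - p i * Real.log (q j) - (p i - q j)) := by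
  have := intervalIntegral.integral_eq_sub_of_hasDerivAt (a := 0) (b := 1)
    (f := fun u => ∑ i, ∑ j, Complex.normSq ((Uᴴ * V) i j) *
      (p i * Real.log ((1 - u) * q j + u * p i) - (p i - q j) * u))
    (f' := fun u => (1 - u) * Qf U V p q u) ?_ (Qf_cont hp hq).intervalIntegrable
  · rw [this]
    simp only [← Finset.sum_sub_distrib]
    refine Finset.sum_congr rfl fun i _ => Finset.sum_congr rfl fun j _ => ?_
    simp
    ring
  · intro u hu
    rw [Set.uIcc_of_le zero_le_one] at hu
    simp only [Qf, Finset.mul_sum]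
    refine HasDerivAt.fun_sum fun i _ => HasDerivAt.fun_sum fun j _ => ?_
    exact ((scalar_hasDeriv (hp i) (hq j) hu.1 hu.2).const_mul
      (Complex.normSq ((Uᴴ * V) i j))).congr_deriv (by ring)

lemma sum_normSq_row {T : Matrix n n ℂ} (h : T * Tᴴ = 1) (i : n) :
    ∑ j, Complex.normSq (T i j) = 1 := by
  have := congrArg (fun M : Matrix n n ℂ => (M i i).re) h
  simpa [Matrix.mul_apply, Complex.normSq_apply] using this

lemma sum_normSq_col {T : Matrix n n ℂ} (h : Tᴴ * T = 1) (j : n) :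
    ∑ i, Complex.normSq (T i j) = 1 := by
  have := congrArg (fun M : Matrix n n ℂ => (M j j).re) h
  simpa [Matrix.mul_apply, Complex.normSq_apply] using this

lemma sum_normSq_diag {U : Matrix n n ℂ} {p : n → ℝ} {ρ : Matrix n n ℂ} (hρ : IsD U p ρ)
    (V : Matrix n n ℂ) (j : n) :
    ∑ i, Complex.normSq ((Uᴴ * V) i j) * p i = ((Vᴴ * ρ * V) j j).re := by
  have e : Vᴴ * ρ * V = (Uᴴ * V)ᴴ * (diagonal (fun i => (p i : ℂ)) * (Uᴴ * V)) := by
    rw [hρ.1]; simp [mul_assoc]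
  rw [e]
  generalize Uᴴ * V = T
  rw [Matrix.mul_apply, Complex.re_sum]
  refine Finset.sum_congr rfl fun i _ => ?_
  rw [diagonal_mul, conjTranspose_apply, mul_left_comm, Complex.re_ofReal_mul, mul_comm]
  simp [Complex.normSq_apply]

lemma IsD.sum_eq {U : Matrix n n ℂ} {p : n → ℝ} {ρ : Matrix n n ℂ} (hρ : IsD U p ρ) :
    ∑ i, p i = ρ.trace.re := by
  rw [hρ.1, trace_mul_comm, ← mul_assoc, hρ.2, one_mul, trace_diagonal]
  simp

lemma Qf_int' {U V : Matrix n n ℂ} {p q : n → ℝ} {ρ σ : Matrix n n ℂ} (hρ : IsD U p ρ)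
    (hσ : IsD V q σ) (hp : ∀ i, 0 < p i) (hq : ∀ i, 0 < q i) :
    ∫ u in (0:ℝ)..1, (1 - u) * Qf U V p q u = - vNEntropy ρ
      - ∑ j, ((Vᴴ * ρ * V) j j).re * Real.log (q j) - (ρ.trace.re - σ.trace.re) := by
  have hU' := mul_eq_one_comm.1 hρ.2
  have hV' := mul_eq_one_comm.1 hσ.2
  have ht : (Uᴴ * V) * (Uᴴ * V)ᴴ = 1 := by
    calc _ = Uᴴ * (V * Vᴴ) * U := by simp [mul_assoc]
      _ = 1 := by rw [hV', mul_one, hρ.2]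
  rw [Qf_int hp hq, hρ.vN, ← hρ.sum_eq, ← hσ.sum_eq]
  have e1 : ∑ i, ∑ j, Complex.normSq ((Uᴴ * V) i j) * (p i * Real.log (p i) - p i)
      = ∑ i, (p i * Real.log (p i) - p i) := by
    refine Finset.sum_congr rfl fun i _ => ?_
    rw [← Finset.sum_mul, sum_normSq_row ht, one_mul]
  have e2 : ∑ i, ∑ j, Complex.normSq ((Uᴴ * V) i j) * q j = ∑ j, q j := by
    rw [Finset.sum_comm]
    refine Finset.sum_congr rfl fun i _ => ?_
    rw [← Finset.sum_mul, sum_normSq_col (mul_eq_one_comm.1 ht), one_mul]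
  have e3 : ∑ i, ∑ j, Complex.normSq ((Uᴴ * V) i j) * p i * Real.log (q j)
      = ∑ j, ((Vᴴ * ρ * V) j j).re * Real.log (q j) := by
    rw [Finset.sum_comm]
    refine Finset.sum_congr rfl fun i _ => ?_
    rw [← Finset.sum_mul, sum_normSq_diag hρ]
  calc _ = ∑ i, ∑ j, Complex.normSq ((Uᴴ * V) i j) * (p i * Real.log (p i) - p i)
      - ∑ i, ∑ j, Complex.normSq ((Uᴴ * V) i j) * p i * Real.log (q j)
      + ∑ i, ∑ j, Complex.normSq ((Uᴴ * V) i j) * q j := by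
        simp only [← Finset.sum_sub_distrib, ← Finset.sum_add_distrib]
        refine Finset.sum_congr rfl fun i _ => Finset.sum_congr rfl fun j _ => ?_
        ring
    _ = _ := by
      rw [e1, e2, e3]
      simp only [Real.negMulLog, Finset.sum_sub_distrib, neg_mul, Finset.sum_neg_distrib]
      ring

end

section
variable {m n : Type*} [Fintype m] [DecidableEq m] [Fintype n] [DecidableEq n]

open Kronecker

/-- Partial trace over the second factor. -/
noncomputable def ptr2 (X : Matrix (m × n) (m × n) ℂ) : Matrix m m ℂ :=
  Matrix.of fun a a' => ∑ b, X (a, b) (a', b)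

lemma ptr2_eq_sum (X : Matrix (m × n) (m × n) ℂ) :
    ptr2 X = ∑ b, X.submatrix (fun a => (a, b)) (fun a => (a, b)) := by
  ext a a'; simp [ptr2, Matrix.sum_apply]

lemma ptr2_add (X Y : Matrix (m × n) (m × n) ℂ) : ptr2 (X + Y) = ptr2 X + ptr2 Y := by
  ext a a'; simp [ptr2, Finset.sum_add_distrib]

lemma ptr2_psd {X : Matrix (m × n) (m × n) ℂ} (h : X.PosSemidef) : (ptr2 X).PosSemidef := by
  rw [ptr2_eq_sum]
  exact posSemidef_sum _ fun b _ => h.submatrix _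

lemma ptr2_pd {X : Matrix (m × n) (m × n) ℂ} (h : X.PosDef) (b₀ : n) : (ptr2 X).PosDef := by
  rw [ptr2_eq_sum, ← Finset.add_sum_erase _ _ (Finset.mem_univ b₀)]
  refine PosDef.add_posSemidef (h.submatrix fun a a' haa => (Prod.ext_iff.1 haa).1) ?_
  exact posSemidef_sum _ fun b _ => h.posSemidef.submatrix _

lemma ptr2_smul_one (t : ℂ) :
    ptr2 (t • (1 : Matrix (m × n) (m × n) ℂ)) = ((Fintype.card n : ℂ) * t) • 1 := by
  ext a a'
  by_cases h : a = a' <;> simp [ptr2, h]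

lemma ptr2_conj (A B : Matrix m m ℂ) (X : Matrix (m × n) (m × n) ℂ) :
    ptr2 ((A ⊗ₖ (1 : Matrix n n ℂ)) * X * (B ⊗ₖ (1 : Matrix n n ℂ))) = A * ptr2 X * B := by
  ext a a'
  simp only [ptr2, Matrix.mul_apply, of_apply, kroneckerMap_apply, Fintype.sum_prod_type,
    one_apply, mul_ite, mul_one, mul_zero, ite_mul, zero_mul, Finset.sum_ite_eq,
    Finset.sum_ite_eq', Finset.mem_univ, if_true, Finset.mul_sum, Finset.sum_mul]
  rw [Finset.sum_comm]
  refine Finset.sum_congr rfl fun i _ => ?_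
  rw [Finset.sum_comm]

/-- Conditional entropy. -/
noncomputable def hf (X : Matrix (m × n) (m × n) ℂ) : ℝ := vNEntropy X - vNEntropy (ptr2 X)

lemma isD_kron {U : Matrix m m ℂ} {q : m → ℝ} {Y : Matrix m m ℂ} (h : IsD U q Y) :
    IsD (U ⊗ₖ (1 : Matrix n n ℂ)) (fun x => q x.1) (Y ⊗ₖ (1 : Matrix n n ℂ)) := by
  have e : (diagonal (fun x : m × n => (q x.1 : ℂ)) : Matrix (m × n) (m × n) ℂ)
      = diagonal (fun i => (q i : ℂ)) ⊗ₖ (1 : Matrix n n ℂ) := by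
    rw [← diagonal_one, diagonal_kronecker_diagonal]; simp
  constructor
  · rw [e, conjTranspose_kronecker, ← mul_kronecker_mul, ← mul_kronecker_mul, ← h.1]; simp
  · rw [conjTranspose_kronecker, ← mul_kronecker_mul, h.2]; simp

lemma hf_int {U : Matrix (m × n) (m × n) ℂ} {V : Matrix m m ℂ} {p : m × n → ℝ} {q : m → ℝ}
    {X : Matrix (m × n) (m × n) ℂ} (hX : IsD U p X) (hV : IsD V q (ptr2 X))
    (hp : ∀ i, 0 < p i) (hq : ∀ i : m × n, 0 < q i.1) :
    ∫ u in (0:ℝ)..1, (1 - u) * Qf U (V ⊗ₖ (1 : Matrix n n ℂ)) p (fun x => q x.1) u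
      = - hf X - (X.trace.re - (ptr2 X ⊗ₖ (1 : Matrix n n ℂ)).trace.re) := by
  rw [Qf_int' hX (isD_kron hV) hp hq, hf]
  have e : ∑ x : m × n, (((V ⊗ₖ (1 : Matrix n n ℂ))ᴴ * X * (V ⊗ₖ (1 : Matrix n n ℂ))) x x).re
      * Real.log (q x.1) = - vNEntropy (ptr2 X) := by
    rw [Fintype.sum_prod_type, hV.vN, ← Finset.sum_neg_distrib]
    refine Finset.sum_congr rfl fun a _ => ?_
    simp only
    rw [← Finset.sum_mul, ← Complex.re_sum]
    have := congrFun (congrFun (ptr2_conj Vᴴ V X) a) a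
    simp only [ptr2, of_apply] at this
    rw [conjTranspose_kronecker, conjTranspose_one, this]
    change ((Vᴴ * ptr2 X * V) a a).re * _ = _
    have e2 : Vᴴ * ptr2 X * V = diagonal (fun i => (q i : ℂ)) := by
      calc _ = (Vᴴ * V) * diagonal (fun i => (q i : ℂ)) * (Vᴴ * V) := by
            rw [hV.1]; simp only [mul_assoc]
        _ = _ := by rw [hV.2]; simp
    rw [e2]
    simp [Real.negMulLog]
  rw [e]
  ring

lemma hf_add_pd {X Y : Matrix (m × n) (m × n) ℂ} (hX : X.PosDef) (hY : Y.PosDef) :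
    hf X + hf Y ≤ hf (X + Y) := by
  have key : ∀ {Z : Matrix (m × n) (m × n) ℂ}, Z.PosDef → ∃ (U : Matrix (m × n) (m × n) ℂ)
      (V : Matrix m m ℂ) (p : m × n → ℝ) (q : m → ℝ), IsD U p Z ∧ IsD V q (ptr2 Z) ∧
      (∀ i, 0 < p i) ∧ (∀ i : m × n, 0 < q i.1) := by
    intro Z hZ
    obtain ⟨U, hU⟩ := exists_isD hZ.1
    obtain ⟨V, hV⟩ := exists_isD (ptr2_psd hZ.posSemidef).1
    exact ⟨U, V, _, _, hU, hV, hZ.eigenvalues_pos, fun i => (ptr2_pd hZ i.2).eigenvalues_pos i.1⟩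
  obtain ⟨U, V, p, q, hU, hV, hp, hq⟩ := key (hX.add hY)
  obtain ⟨U₁, V₁, p₁, q₁, hU₁, hV₁, hp₁, hq₁⟩ := key hX
  obtain ⟨U₂, V₂, p₂, q₂, hU₂, hV₂, hp₂, hq₂⟩ := key hY
  have hV' := isD_kron (n := n) hV
  have hadd : ptr2 (X + Y) ⊗ₖ (1 : Matrix n n ℂ)
      = ptr2 X ⊗ₖ (1 : Matrix n n ℂ) + ptr2 Y ⊗ₖ (1 : Matrix n n ℂ) := by
    rw [ptr2_add, add_kronecker]
  rw [hadd] at hV'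
  have i0 := hf_int hU hV hp hq
  have i1 := hf_int hU₁ hV₁ hp₁ hq₁
  have i2 := hf_int hU₂ hV₂ hp₂ hq₂
  rw [hadd] at i0
  have mono := intervalIntegral.integral_mono_on (μ := MeasureTheory.volume) (a := (0:ℝ)) (b := 1) zero_le_one
    (f := fun u => (1 - u) * Qf U (V ⊗ₖ (1 : Matrix n n ℂ)) p (fun x => q x.1) u)
    (g := fun u => (1 - u) * Qf U₁ (V₁ ⊗ₖ (1 : Matrix n n ℂ)) p₁ (fun x => q₁ x.1) u
      + (1 - u) * Qf U₂ (V₂ ⊗ₖ (1 : Matrix n n ℂ)) p₂ (fun x => q₂ x.1) u)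
    (Qf_cont hp hq).intervalIntegrable
    ((Qf_cont hp₁ hq₁).intervalIntegrable.add (Qf_cont hp₂ hq₂).intervalIntegrable)
    (by
      intro u hu
      rw [← mul_add]
      exact mul_le_mul_of_nonneg_left
        (Qf_add hU hV' hU₁ (isD_kron hV₁) hU₂ (isD_kron hV₂) hp hq hp₁ hq₁ hp₂ hq₂ hu.1 hu.2)
        (sub_nonneg.2 hu.2))
  rw [intervalIntegral.integral_add (Qf_cont hp₁ hq₁).intervalIntegrable
    (Qf_cont hp₂ hq₂).intervalIntegrable, i0, i1, i2] at mono
  simp only [trace_add, Complex.add_re] at mono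
  linarith

lemma hf_tendsto {X : Matrix (m × n) (m × n) ℂ} (h : X.PosSemidef) (c : ℝ) :
    Filter.Tendsto (fun t : ℝ => hf (X + ((c * t : ℝ) : ℂ) • 1))
      (nhdsWithin 0 (Set.Ioi 0)) (nhds (hf X)) := by
  unfold hf
  refine (vN_tendsto h.1 c).sub ?_
  have := vN_tendsto (ptr2_psd h).1 (Fintype.card n * c)
  refine this.congr fun t => ?_
  rw [ptr2_add, ptr2_smul_one]
  congr 3
  push_cast; ring

lemma hf_add {X Y : Matrix (m × n) (m × n) ℂ} (hX : X.PosSemidef) (hY : Y.PosSemidef) :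
    hf X + hf Y ≤ hf (X + Y) := by
  refine le_of_tendsto_of_tendsto ((hf_tendsto hX 1).add (hf_tendsto hY 1))
    (hf_tendsto (hX.add hY) 2) ?_
  filter_upwards [self_mem_nhdsWithin] with t ht
  have hpd : (((1 * t : ℝ) : ℂ) • (1 : Matrix (m × n) (m × n) ℂ)).PosDef := by
    rw [one_mul]
    exact PosDef.one.smul (by simpa using ht)
  refine (hf_add_pd (PosDef.posSemidef_add hX hpd) (PosDef.posSemidef_add hY hpd)).trans_eq ?_
  congr 1
  push_cast
  module

end

section
variable {dA dB dC : ℕ}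

/-- `margBC` with the two factors swapped. -/
noncomputable def margCB
    (ρ : Matrix (Fin dA × Fin dB × Fin dC) (Fin dA × Fin dB × Fin dC) ℂ) :
    Matrix (Fin dC × Fin dB) (Fin dC × Fin dB) ℂ :=
  (margBC ρ).submatrix (Equiv.prodComm _ _).symm (Equiv.prodComm _ _).symm

lemma margAB_psd {ρ : Matrix (Fin dA × Fin dB × Fin dC) (Fin dA × Fin dB × Fin dC) ℂ}
    (h : ρ.PosSemidef) : (margAB ρ).PosSemidef := by
  have : margAB ρ = ∑ c, ρ.submatrix (fun x : Fin dA × Fin dB => (x.1, x.2, c))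
      (fun x : Fin dA × Fin dB => (x.1, x.2, c)) := by
    ext x y; simp [margAB, Matrix.sum_apply]
  rw [this]
  exact posSemidef_sum _ fun b _ => h.submatrix _

lemma margBC_psd {ρ : Matrix (Fin dA × Fin dB × Fin dC) (Fin dA × Fin dB × Fin dC) ℂ}
    (h : ρ.PosSemidef) : (margBC ρ).PosSemidef := by
  have : margBC ρ = ∑ a, ρ.submatrix (fun x : Fin dB × Fin dC => (a, x.1, x.2))
      (fun x : Fin dB × Fin dC => (a, x.1, x.2)) := by
    ext x y; simp [margBC, Matrix.sum_apply]
  rw [this]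
  exact posSemidef_sum _ fun b _ => h.submatrix _

lemma ptr2_margAB (ρ : Matrix (Fin dA × Fin dB × Fin dC) (Fin dA × Fin dB × Fin dC) ℂ) :
    ptr2 (margAB ρ) = margA ρ := by
  ext a a'; simp [ptr2, margAB, margA]

lemma ptr2_margCB (ρ : Matrix (Fin dA × Fin dB × Fin dC) (Fin dA × Fin dB × Fin dC) ℂ) :
    ptr2 (margCB ρ) = margC ρ := by
  ext a a'; simp [ptr2, margCB, margBC, margC]; rw [Finset.sum_comm]

/-- The defect functional `S(AB) - S(A) + S(BC) - S(C)`. -/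
noncomputable def gf (ρ : Matrix (Fin dA × Fin dB × Fin dC) (Fin dA × Fin dB × Fin dC) ℂ) : ℝ :=
  hf (margAB ρ) + hf (margCB ρ)

lemma gf_eq {ρ : Matrix (Fin dA × Fin dB × Fin dC) (Fin dA × Fin dB × Fin dC) ℂ}
    (h : ρ.PosSemidef) : gf ρ = vNEntropy (margAB ρ) - vNEntropy (margA ρ)
      + (vNEntropy (margBC ρ) - vNEntropy (margC ρ)) := by
  rw [gf, hf, hf, ptr2_margAB, ptr2_margCB, margCB, vN_reindex (margBC_psd h).1]

lemma gf_add {ρ σ : Matrix (Fin dA × Fin dB × Fin dC) (Fin dA × Fin dB × Fin dC) ℂ}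
    (hρ : ρ.PosSemidef) (hσ : σ.PosSemidef) : gf ρ + gf σ ≤ gf (ρ + σ) := by
  have e1 : margAB (ρ + σ) = margAB ρ + margAB σ := by
    ext x y; simp [margAB, Finset.sum_add_distrib]
  have e2 : margCB (ρ + σ) = margCB ρ + margCB σ := by
    ext x y; simp [margCB, margBC, Finset.sum_add_distrib]
  have h1 := hf_add (margAB_psd hρ) (margAB_psd hσ)
  have h2 := hf_add (X := margCB ρ) (Y := margCB σ)
    ((margBC_psd hρ).submatrix _) ((margBC_psd hσ).submatrix _)
  rw [gf, gf, gf, e1, e2]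
  linarith

lemma gf_pure (ψ : Fin dA × Fin dB × Fin dC → ℂ) : gf (vecMulVec ψ (star ψ)) = 0 := by
  rw [gf_eq (posSemidef_vecMulVec_self_star ψ)]
  have h1 := vN_schmidt (Matrix.of fun (a : Fin dA) (x : Fin dB × Fin dC) => ψ (a, x.1, x.2))
  have h2 := vN_schmidt (Matrix.of fun (c : Fin dC) (x : Fin dA × Fin dB) => ψ (x.1, x.2, c))
  have a1 : margA (vecMulVec ψ (star ψ))
      = (Matrix.of fun (a : Fin dA) (x : Fin dB × Fin dC) => ψ (a, x.1, x.2))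
        * (Matrix.of fun (a : Fin dA) (x : Fin dB × Fin dC) => ψ (a, x.1, x.2))ᴴ := by
    ext; simp [margA, Matrix.mul_apply, vecMulVec_apply, Fintype.sum_prod_type]
  have a2 : margBC (vecMulVec ψ (star ψ))
      = (Matrix.of fun (a : Fin dA) (x : Fin dB × Fin dC) => ψ (a, x.1, x.2))ᵀ
        * (Matrix.of fun (a : Fin dA) (x : Fin dB × Fin dC) => ψ (a, x.1, x.2))ᵀᴴ := by
    ext; simp [margBC, Matrix.mul_apply, vecMulVec_apply]
  have a3 : margC (vecMulVec ψ (star ψ))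
      = (Matrix.of fun (c : Fin dC) (x : Fin dA × Fin dB) => ψ (x.1, x.2, c))
        * (Matrix.of fun (c : Fin dC) (x : Fin dA × Fin dB) => ψ (x.1, x.2, c))ᴴ := by
    ext; simp [margC, Matrix.mul_apply, vecMulVec_apply, Fintype.sum_prod_type]
  have a4 : margAB (vecMulVec ψ (star ψ))
      = (Matrix.of fun (c : Fin dC) (x : Fin dA × Fin dB) => ψ (x.1, x.2, c))ᵀ
        * (Matrix.of fun (c : Fin dC) (x : Fin dA × Fin dB) => ψ (x.1, x.2, c))ᵀᴴ := by
    ext; simp [margAB, Matrix.mul_apply, vecMulVec_apply]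
  rw [a1, a2, a3, a4, h1, h2]
  ring

lemma gf_nonneg {ρ : Matrix (Fin dA × Fin dB × Fin dC) (Fin dA × Fin dB × Fin dC) ℂ}
    (hρ : ρ.PosSemidef) : 0 ≤ gf ρ := by
  have key : ∀ {N : ℕ} (s : Finset (Fin N))
      (ψ : Fin N → Fin dA × Fin dB × Fin dC → ℂ),
      0 ≤ gf (∑ k ∈ s, vecMulVec (ψ k) (star (ψ k))) := by
    intro N s ψ
    induction s using Finset.induction_on with
    | empty =>
      have := gf_pure (0 : Fin dA × Fin dB × Fin dC → ℂ)
      simp only [zero_vecMulVec] at this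
      simp [this]
    | insert k s hk ih =>
      rw [Finset.sum_insert hk]
      refine le_trans ?_ (gf_add (posSemidef_vecMulVec_self_star _)
        (posSemidef_sum _ fun k _ => posSemidef_vecMulVec_self_star _))
      rw [gf_pure]
      simpa using ih
  obtain ⟨N, ψ, hψ⟩ := posSemidef_iff_eq_sum_vecMulVec.1 hρ
  rw [hψ]
  exact key _ ψ

end

/-- for every tripartite density matrix `ρ` the quantum mutual
informations obey the monogamy relation `I(A:B) + I(B:C) ≤ 2 S(ρ_B)`. -/
theorem stmt_11 {dA dB dC : ℕ}
    (ρ : Matrix (Fin dA × Fin dB × Fin dC) (Fin dA × Fin dB × Fin dC) ℂ)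
    (hρ : ρ.PosSemidef) (htr : ρ.trace = 1) :
    (vNEntropy (margA ρ) + vNEntropy (margB ρ) - vNEntropy (margAB ρ))
      + (vNEntropy (margB ρ) + vNEntropy (margC ρ) - vNEntropy (margBC ρ))
      ≤ 2 * vNEntropy (margB ρ) := by
  have h := gf_nonneg hρ
  rw [gf_eq hρ] at h
  linarith
end

section
/- For every rank-one (pure) N-partite density matrix ρ of local dimension d with N ≥ 3, the N-partite dependence satisfies D_N(ρ) ≤ log d. -/
open Matrix ComplexOrder

/-- scalar integration step -/
lemma scalar_int {I I' : Type*} [Fintype I] [Fintype I'] (w p q : I → ℝ) (w' p' q' : I' → ℝ)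
    (hp : ∀ i, 0 ≤ p i) (hq : ∀ i, 0 < q i) (hp' : ∀ i, 0 ≤ p' i) (hq' : ∀ i, 0 < q' i)
    (hF : ∀ t : ℝ, 0 ≤ t → ∑ i, w' i * (p' i ^ 2 / (q' i + t * p' i))
      ≤ ∑ i, w i * (p i ^ 2 / (q i + t * p i)))
    (htr : ∑ i, w' i * p' i = ∑ i, w i * p i) :
    ∑ i, w' i * (p' i * (Real.log (p' i) - Real.log (q' i)))
      ≤ ∑ i, w i * (p i * (Real.log (p i) - Real.log (q i))) := by
  have key : ∀ {J : Type _} [Fintype J] (w p q : J → ℝ) (hp : ∀ i, 0 ≤ p i) (hq : ∀ i, 0 < q i)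
      (t : ℝ) (ht : 0 ≤ t),
      HasDerivAt (fun t => ∑ i, w i * (p i * (Real.log (q i + t * p i) - Real.log (q i))))
        (∑ i, w i * (p i ^ 2 / (q i + t * p i))) t := by
    intro J _ w p q hp hq t ht
    apply HasDerivAt.fun_sum
    intro i _
    apply HasDerivAt.const_mul
    have h0 : q i + t * p i ≠ 0 := by
      have := hp i; have := hq i; positivity
    have h1 : HasDerivAt (fun t => q i + t * p i) (p i) t := by
      simpa using ((hasDerivAt_id t).mul_const (p i)).const_add (q i)
    have h2 := ((h1.log h0).sub_const (Real.log (q i))).const_mul (p i)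
    convert h2 using 1
    ring
  have key' : ∀ (t : ℝ) (ht : 0 ≤ t),
      HasDerivAt (fun t => ∑ i, w' i * (p' i * (Real.log (q' i + t * p' i) - Real.log (q' i))))
        (∑ i, w' i * (p' i ^ 2 / (q' i + t * p' i))) t := by
    intro t ht
    apply HasDerivAt.fun_sum
    intro i _
    apply HasDerivAt.const_mul
    have h0 : q' i + t * p' i ≠ 0 := by
      have := hp' i; have := hq' i; positivity
    have h1 : HasDerivAt (fun t => q' i + t * p' i) (p' i) t := by
      simpa using ((hasDerivAt_id t).mul_const (p' i)).const_add (q' i)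
    have h2 := ((h1.log h0).sub_const (Real.log (q' i))).const_mul (p' i)
    convert h2 using 1
    ring
  have mono : MonotoneOn (fun t : ℝ =>
      (∑ i, w i * (p i * (Real.log (q i + t * p i) - Real.log (q i)))) -
      ∑ i, w' i * (p' i * (Real.log (q' i + t * p' i) - Real.log (q' i)))) (Set.Ici 0) := by
    apply monotoneOn_of_hasDerivWithinAt_nonneg (convex_Ici 0)
      (f' := fun t => (∑ i, w i * (p i ^ 2 / (q i + t * p i))) -
        ∑ i, w' i * (p' i ^ 2 / (q' i + t * p' i)))
    · intro t ht
      exact ((key w p q hp hq t ht).sub (key' t ht)).continuousAt.continuousWithinAt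
    · intro t ht
      rw [interior_Ici] at ht
      exact ((key w p q hp hq t (le_of_lt ht)).sub (key' t (le_of_lt ht))).hasDerivWithinAt
    · intro t ht
      rw [interior_Ici] at ht
      have := hF t (le_of_lt ht)
      linarith
  have lim1 : ∀ (p q : ℝ), 0 ≤ p → Filter.Tendsto
      (fun t : ℝ => p * (Real.log (q + t * p) - Real.log q) - p * Real.log t) Filter.atTop
      (nhds (p * (Real.log p - Real.log q))) := by
    intro p q hp
    rcases hp.eq_or_lt with h | h
    · subst h; simp
    have h1 : Filter.Tendsto (fun t : ℝ => q / t + p) Filter.atTop (nhds (0 + p)) :=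
      (Filter.Tendsto.const_div_atTop Filter.tendsto_id q).add_const p
    rw [zero_add] at h1
    have h2 := (((h1.log h.ne')).sub_const (Real.log q)).const_mul p
    refine h2.congr' ?_
    have h3 := h1.eventually (lt_mem_nhds h)
    filter_upwards [h3, Filter.eventually_gt_atTop 0] with t ht ht0
    have : q + t * p = (q / t + p) * t := by field_simp
    rw [this, Real.log_mul ht.ne' ht0.ne']
    ring
  have L : Filter.Tendsto (fun t : ℝ => ∑ i, w i * (p i * (Real.log (q i + t * p i) - Real.log (q i)) - p i * Real.log t)) Filter.atTop
      (nhds (∑ i, w i * (p i * (Real.log (p i) - Real.log (q i))))) :=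
    tendsto_finsetSum _ fun i _ => (lim1 (p i) (q i) (hp i)).const_mul (w i)
  have L' : Filter.Tendsto (fun t : ℝ => ∑ i, w' i * (p' i * (Real.log (q' i + t * p' i) - Real.log (q' i)) - p' i * Real.log t)) Filter.atTop
      (nhds (∑ i, w' i * (p' i * (Real.log (p' i) - Real.log (q' i))))) :=
    tendsto_finsetSum _ fun i _ => (lim1 (p' i) (q' i) (hp' i)).const_mul (w' i)
  refine le_of_tendsto_of_tendsto L' L ?_
  filter_upwards [Filter.eventually_ge_atTop 0] with t ht
  have h := mono (Set.mem_Ici.2 le_rfl) (Set.mem_Ici.2 ht) ht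
  simp only [zero_mul, add_zero, sub_self, mul_zero, Finset.sum_const_zero] at h
  have e1 : ∑ i, w i * (p i * (Real.log (q i + t * p i) - Real.log (q i)) - p i * Real.log t)
      = (∑ i, w i * (p i * (Real.log (q i + t * p i) - Real.log (q i)))) - (∑ i, w i * p i) * Real.log t := by
    rw [Finset.sum_mul, ← Finset.sum_sub_distrib]
    exact Finset.sum_congr rfl fun i _ => by ring
  have e2 : ∑ i, w' i * (p' i * (Real.log (q' i + t * p' i) - Real.log (q' i)) - p' i * Real.log t)
      = (∑ i, w' i * (p' i * (Real.log (q' i + t * p' i) - Real.log (q' i)))) - (∑ i, w' i * p' i) * Real.log t := by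
    rw [Finset.sum_mul, ← Finset.sum_sub_distrib]
    exact Finset.sum_congr rfl fun i _ => by ring
  rw [e1, e2, htr]
  linarith

/-- the quadratic functional whose supremum is the resolvent quasi-entropy -/
noncomputable def Fn {n : Type*} [Fintype n] (ρ σ X : Matrix n n ℂ) (t : ℝ) : ℝ :=
  (2 * trace (Xᴴ * ρ) - trace (Xᴴ * σ * X) - t * trace (Xᴴ * X * ρ)).re

lemma Fn_eq {n I J : Type*} [Fintype n] [Fintype I] [Fintype J] [DecidableEq n]
    [DecidableEq I] [DecidableEq J]
    (ρ σ : Matrix n n ℂ) (U : Matrix n I ℂ) (V : Matrix n J ℂ) (p : I → ℝ) (q : J → ℝ)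
    (hU : Uᴴ * U = 1) (hV : Vᴴ * V = 1)
    (hρ : ρ = U * diagonal (fun i => (p i : ℂ)) * Uᴴ)
    (hσ : σ = V * diagonal (fun i => (q i : ℂ)) * Vᴴ) (Y : Matrix J I ℂ) (t : ℝ) :
    Fn ρ σ (V * Y * Uᴴ) t = ∑ x : J × I, (2 * (star (Y x.1 x.2) * (Vᴴ * U) x.1 x.2).re * p x.2
      - Complex.normSq (Y x.1 x.2) * (q x.1 + t * p x.2)) := by
  set P := diagonal (fun i => (p i : ℂ)) with hP
  set Q := diagonal (fun i => (q i : ℂ)) with hQ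
  have e1 : trace ((V * Y * Uᴴ)ᴴ * ρ) = trace (Yᴴ * (Vᴴ * U) * P) := by
    rw [hρ]
    simp only [conjTranspose_mul, conjTranspose_conjTranspose]
    rw [show U * (Yᴴ * Vᴴ) * (U * P * Uᴴ) = U * ((Yᴴ * (Vᴴ * U) * P) * Uᴴ) by
      simp only [Matrix.mul_assoc], trace_mul_comm, Matrix.mul_assoc, hU, Matrix.mul_one]
  have e2 : trace ((V * Y * Uᴴ)ᴴ * σ * (V * Y * Uᴴ)) = trace (Yᴴ * Q * Y) := by
    rw [hσ]
    simp only [conjTranspose_mul, conjTranspose_conjTranspose]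
    rw [show U * (Yᴴ * Vᴴ) * (V * Q * Vᴴ) * (V * Y * Uᴴ)
      = U * ((Yᴴ * (Vᴴ * V) * Q * (Vᴴ * V) * Y) * Uᴴ) by
      simp only [Matrix.mul_assoc], trace_mul_comm, Matrix.mul_assoc, hU, hV]
    simp [Matrix.mul_assoc]
  have e3 : trace ((V * Y * Uᴴ)ᴴ * (V * Y * Uᴴ) * ρ) = trace (Yᴴ * Y * P) := by
    rw [hρ]
    simp only [conjTranspose_mul, conjTranspose_conjTranspose]
    rw [show U * (Yᴴ * Vᴴ) * (V * Y * Uᴴ) * (U * P * Uᴴ)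
      = U * ((Yᴴ * (Vᴴ * V) * Y * (Uᴴ * U) * P) * Uᴴ) by
      simp only [Matrix.mul_assoc], trace_mul_comm, Matrix.mul_assoc, hU, hV]
    simp [Matrix.mul_assoc]
  unfold Fn
  rw [e1, e2, e3]
  have f1 : trace (Yᴴ * (Vᴴ * U) * P) = ∑ x : J × I, star (Y x.1 x.2) * (Vᴴ * U) x.1 x.2 * p x.2 := by
    rw [Fintype.sum_prod_type_right]
    simp only [trace, diag, hP, mul_diagonal]
    refine Finset.sum_congr rfl fun i _ => ?_
    rw [Matrix.mul_apply, Finset.sum_mul]; rfl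
  have f2 : trace (Yᴴ * Q * Y) = ∑ x : J × I, star (Y x.1 x.2) * Y x.1 x.2 * q x.1 := by
    rw [Fintype.sum_prod_type_right]
    refine Finset.sum_congr rfl fun i _ => Finset.sum_congr rfl fun j _ => ?_
    change (Yᴴ * Q) i j * Y j i = star (Y j i) * Y j i * q j
    rw [hQ, mul_diagonal, conjTranspose_apply]; ring
  have f3 : trace (Yᴴ * Y * P) = ∑ x : J × I, star (Y x.1 x.2) * Y x.1 x.2 * p x.2 := by
    rw [Fintype.sum_prod_type_right]
    simp only [trace, diag, hP, mul_diagonal]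
    refine Finset.sum_congr rfl fun i _ => ?_
    rw [Matrix.mul_apply, Finset.sum_mul]; rfl
  rw [f1, f2, f3, Finset.mul_sum, Finset.mul_sum, ← Finset.sum_sub_distrib, ← Finset.sum_sub_distrib,
    Complex.re_sum]
  refine Finset.sum_congr rfl fun x _ => ?_
  have : star (Y x.1 x.2) * Y x.1 x.2 = (Complex.normSq (Y x.1 x.2) : ℂ) := by
    rw [Complex.normSq_eq_conj_mul_self]; rfl
  rw [this]
  generalize (star (Y x.1 x.2) * (Vᴴ * U) x.1 x.2) = z
  simp
  ring

lemma Fn_le {n I J : Type*} [Fintype n] [Fintype I] [Fintype J] [DecidableEq n]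
    [DecidableEq I] [DecidableEq J]
    (ρ σ : Matrix n n ℂ) (U : Matrix n I ℂ) (V : Matrix n J ℂ) (p : I → ℝ) (q : J → ℝ)
    (hU : Uᴴ * U = 1) (hV : Vᴴ * V = 1) (hU' : U * Uᴴ = 1) (hV' : V * Vᴴ = 1)
    (hρ : ρ = U * diagonal (fun i => (p i : ℂ)) * Uᴴ)
    (hσ : σ = V * diagonal (fun i => (q i : ℂ)) * Vᴴ)
    (hp : ∀ i, 0 ≤ p i) (hq : ∀ i, 0 < q i) (X : Matrix n n ℂ) (t : ℝ) (ht : 0 ≤ t) :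
    Fn ρ σ X t ≤ ∑ x : J × I, Complex.normSq ((Vᴴ * U) x.1 x.2) *
      (p x.2 ^ 2 / (q x.1 + t * p x.2)) := by
  have hX : X = V * (Vᴴ * X * U) * Uᴴ := by
    rw [show V * (Vᴴ * X * U) * Uᴴ = (V * Vᴴ) * X * (U * Uᴴ) by simp only [Matrix.mul_assoc], hU', hV']
    simp
  rw [hX, Fn_eq ρ σ U V p q hU hV hρ hσ]
  refine Finset.sum_le_sum fun x _ => ?_
  have hs : 0 < q x.1 + t * p x.2 := by
    have := hp x.2; have := hq x.1; positivity
  generalize (Vᴴ * X * U) x.1 x.2 = y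
  generalize (Vᴴ * U) x.1 x.2 = z
  generalize q x.1 + t * p x.2 = s at *
  generalize p x.2 = r
  rw [← mul_div_assoc, le_div_iff₀ hs]
  simp [Complex.normSq_apply]
  nlinarith [sq_nonneg (y.re * s - z.re * r), sq_nonneg (y.im * s - z.im * r)]

lemma Fn_attain {n I J : Type*} [Fintype n] [Fintype I] [Fintype J] [DecidableEq n]
    [DecidableEq I] [DecidableEq J]
    (ρ σ : Matrix n n ℂ) (U : Matrix n I ℂ) (V : Matrix n J ℂ) (p : I → ℝ) (q : J → ℝ)
    (hU : Uᴴ * U = 1) (hV : Vᴴ * V = 1)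
    (hρ : ρ = U * diagonal (fun i => (p i : ℂ)) * Uᴴ)
    (hσ : σ = V * diagonal (fun i => (q i : ℂ)) * Vᴴ)
    (hp : ∀ i, 0 ≤ p i) (hq : ∀ i, 0 < q i) (t : ℝ) (ht : 0 ≤ t) :
    ∃ X : Matrix n n ℂ, Fn ρ σ X t = ∑ x : J × I, Complex.normSq ((Vᴴ * U) x.1 x.2) *
      (p x.2 ^ 2 / (q x.1 + t * p x.2)) := by
  refine ⟨V * (Matrix.of fun j i => (Vᴴ * U) j i * ((p i / (q j + t * p i) : ℝ) : ℂ)) * Uᴴ, ?_⟩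
  rw [Fn_eq ρ σ U V p q hU hV hρ hσ]
  refine Finset.sum_congr rfl fun x _ => ?_
  have hs : 0 < q x.1 + t * p x.2 := by
    have := hp x.2; have := hq x.1; positivity
  simp only [Matrix.of_apply]
  generalize (Vᴴ * U) x.1 x.2 = z
  generalize q x.1 + t * p x.2 = s at *
  generalize p x.2 = r
  have h1 : (star (z * ((r / s : ℝ) : ℂ)) * z).re = Complex.normSq z * (r / s) := by
    simp [Complex.normSq_apply, -Complex.ofReal_div]; ring
  rw [h1, Complex.normSq_mul, Complex.normSq_ofReal]
  field_simp
  ring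

/-- partial trace over the first factor -/
def pt1 {α κ : Type*} [Fintype α] (ρ : Matrix (α × κ) (α × κ) ℂ) : Matrix κ κ ℂ :=
  Matrix.of fun x y => ∑ a, ρ (a, x) (a, y)

/-- `1 ⊗ X` -/
def lift1 {α κ : Type*} [DecidableEq α] (X : Matrix κ κ ℂ) : Matrix (α × κ) (α × κ) ℂ :=
  Matrix.of fun x y => if x.1 = y.1 then X x.2 y.2 else 0

lemma lift1_mul {α κ : Type*} [Fintype α] [Fintype κ] [DecidableEq α] (X Y : Matrix κ κ ℂ) :
    (lift1 X * lift1 Y : Matrix (α × κ) (α × κ) ℂ) = lift1 (X * Y) := by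
  ext x y
  simp only [lift1, Matrix.mul_apply, Matrix.of_apply, Fintype.sum_prod_type_right]
  by_cases h : x.1 = y.1 <;> simp [h]

lemma lift1_conj {α κ : Type*} [DecidableEq α] (X : Matrix κ κ ℂ) :
    ((lift1 X)ᴴ : Matrix (α × κ) (α × κ) ℂ) = lift1 Xᴴ := by
  ext x y
  simp only [lift1, Matrix.conjTranspose_apply, Matrix.of_apply]
  by_cases h : x.1 = y.1 <;> simp [h, eq_comm]

lemma trace_lift1 {α κ : Type*} [Fintype α] [Fintype κ] [DecidableEq α] (X : Matrix κ κ ℂ)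
    (ρ : Matrix (α × κ) (α × κ) ℂ) : trace (lift1 X * ρ) = trace (X * pt1 ρ) := by
  simp only [trace, diag, Matrix.mul_apply, lift1, pt1, Matrix.of_apply, Fintype.sum_prod_type,
    ite_mul, zero_mul, Finset.mul_sum]
  rw [Finset.sum_comm]
  refine Finset.sum_congr rfl fun k _ => ?_
  rw [Finset.sum_comm]
  rw [Finset.sum_comm]
  simp only [Finset.sum_comm (s := (Finset.univ : Finset α)) (t := (Finset.univ : Finset κ))]
  simp

lemma Fn_lift1 {α κ : Type*} [Fintype α] [Fintype κ] [DecidableEq α] (X : Matrix κ κ ℂ)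
    (ρ σ : Matrix (α × κ) (α × κ) ℂ) (t : ℝ) : Fn ρ σ (lift1 X) t = Fn (pt1 ρ) (pt1 σ) X t := by
  unfold Fn
  rw [lift1_conj, lift1_mul, trace_lift1, trace_lift1, trace_mul_comm _ (lift1 X), ← Matrix.mul_assoc,
    lift1_mul, trace_lift1, trace_mul_comm _ X, Matrix.mul_assoc]

lemma sum_weight {n I J : Type*} [Fintype n] [Fintype I] [Fintype J] [DecidableEq n]
    [DecidableEq I] [DecidableEq J] (U : Matrix n I ℂ) (V : Matrix n J ℂ)
    (hU : Uᴴ * U = 1) (hV' : V * Vᴴ = 1) (i : I) :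
    ∑ j, Complex.normSq ((Vᴴ * U) j i) = 1 := by
  have h : ((Vᴴ * U)ᴴ * (Vᴴ * U)) i i = 1 := by
    rw [conjTranspose_mul, conjTranspose_conjTranspose,
      show Uᴴ * V * (Vᴴ * U) = Uᴴ * (V * Vᴴ) * U by simp only [Matrix.mul_assoc], hV']
    simp [hU]
  rw [Matrix.mul_apply] at h
  have h2 := congrArg Complex.re h
  rw [Complex.re_sum] at h2
  rw [Complex.one_re] at h2
  rw [← h2]
  refine Finset.sum_congr rfl fun j _ => ?_
  simp only [conjTranspose_apply]
  generalize (Vᴴ * U) j i = z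
  simp [Complex.normSq_apply]

lemma trace_spec {n I : Type*} [Fintype n] [Fintype I] [DecidableEq n]
    [DecidableEq I] (ρ : Matrix n n ℂ) (U : Matrix n I ℂ) (p : I → ℝ)
    (hU : Uᴴ * U = 1)
    (hρ : ρ = U * diagonal (fun i => (p i : ℂ)) * Uᴴ) : trace ρ = ((∑ i, p i : ℝ) : ℂ) := by
  rw [hρ, trace_mul_comm, ← Matrix.mul_assoc, hU, Matrix.one_mul, trace_diagonal]
  simp

/-- monotonicity of relative entropy under partial trace, in spectral form -/
lemma rel_mono {α κ I J I' J' : Type*} [Fintype α] [Fintype κ] [Fintype I] [Fintype J] [Fintype I']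
    [Fintype J'] [DecidableEq α] [DecidableEq κ] [DecidableEq I] [DecidableEq J] [DecidableEq I']
    [DecidableEq J'] (ρ σ : Matrix (α × κ) (α × κ) ℂ)
    (U : Matrix (α × κ) I ℂ) (V : Matrix (α × κ) J ℂ) (p : I → ℝ) (q : J → ℝ)
    (hU : Uᴴ * U = 1) (hV : Vᴴ * V = 1) (hU' : U * Uᴴ = 1) (hV' : V * Vᴴ = 1)
    (hρ : ρ = U * diagonal (fun i => (p i : ℂ)) * Uᴴ)
    (hσ : σ = V * diagonal (fun i => (q i : ℂ)) * Vᴴ)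
    (hp : ∀ i, 0 ≤ p i) (hq : ∀ i, 0 < q i)
    (U₁ : Matrix κ I' ℂ) (V₁ : Matrix κ J' ℂ) (p₁ : I' → ℝ) (q₁ : J' → ℝ)
    (hU₁ : U₁ᴴ * U₁ = 1) (hV₁ : V₁ᴴ * V₁ = 1) (hV₁' : V₁ * V₁ᴴ = 1)
    (hρ₁ : pt1 ρ = U₁ * diagonal (fun i => (p₁ i : ℂ)) * U₁ᴴ)
    (hσ₁ : pt1 σ = V₁ * diagonal (fun i => (q₁ i : ℂ)) * V₁ᴴ)
    (hp₁ : ∀ i, 0 ≤ p₁ i) (hq₁ : ∀ i, 0 < q₁ i) :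
    ∑ x : J' × I', Complex.normSq ((V₁ᴴ * U₁) x.1 x.2) *
        (p₁ x.2 * (Real.log (p₁ x.2) - Real.log (q₁ x.1))) ≤
    ∑ x : J × I, Complex.normSq ((Vᴴ * U) x.1 x.2) *
        (p x.2 * (Real.log (p x.2) - Real.log (q x.1))) := by
  refine scalar_int (fun x : J × I => Complex.normSq ((Vᴴ * U) x.1 x.2)) (fun x => p x.2)
    (fun x => q x.1) (fun x : J' × I' => Complex.normSq ((V₁ᴴ * U₁) x.1 x.2)) (fun x => p₁ x.2)
    (fun x => q₁ x.1) (fun _ => hp _) (fun _ => hq _) (fun _ => hp₁ _) (fun _ => hq₁ _) ?_ ?_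
  · intro t ht
    obtain ⟨X, hX⟩ := Fn_attain _ _ U₁ V₁ p₁ q₁ hU₁ hV₁ hρ₁ hσ₁ hp₁ hq₁ t ht
    rw [← hX, ← Fn_lift1]
    exact Fn_le ρ σ U V p q hU hV hU' hV' hρ hσ hp hq _ t ht
  · rw [Fintype.sum_prod_type_right, Fintype.sum_prod_type_right]
    simp only [← Finset.sum_mul, sum_weight U V hU hV', sum_weight U₁ V₁ hU₁ hV₁', one_mul]
    have h1 := trace_spec ρ U p hU hρ
    have h2 := trace_spec _ U₁ p₁ hU₁ hρ₁
    have h3 : trace ρ = trace (pt1 ρ) := by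
      simp only [trace, diag, pt1, Matrix.of_apply]
      rw [Fintype.sum_prod_type_right]
    rw [h1, h2] at h3
    exact_mod_cast h3.symm

lemma spec_psd {n : Type*} [Fintype n] [DecidableEq n] {A : Matrix n n ℂ} (hA : A.PosSemidef) :
    ∃ (U : Matrix n n ℂ) (p : n → ℝ), Uᴴ * U = 1 ∧ U * Uᴴ = 1 ∧ (∀ i, 0 ≤ p i) ∧
      A = U * diagonal (fun i => (p i : ℂ)) * Uᴴ ∧ vNEntropy A = ∑ i, Real.negMulLog (p i) := by
  refine ⟨hA.1.eigenvectorUnitary, hA.1.eigenvalues, ?_, ?_, hA.eigenvalues_nonneg, ?_, ?_⟩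
  · exact Unitary.coe_star_mul_self hA.1.eigenvectorUnitary
  · exact Unitary.coe_mul_star_self hA.1.eigenvectorUnitary
  · exact hA.1.spectral_theorem
  · unfold vNEntropy
    rw [dif_pos hA.1]

lemma entropy_roots {n : Type*} [Fintype n] [DecidableEq n] {A : Matrix n n ℂ} (hA : A.IsHermitian) :
    vNEntropy A = (A.charpoly.roots.map (fun z => Real.negMulLog z.re)).sum := by
  unfold vNEntropy
  rw [dif_pos hA, hA.roots_charpoly_eq_eigenvalues, Multiset.map_map]
  rfl

lemma entropy_reindex {n m : Type*} [Fintype n] [DecidableEq n] [Fintype m] [DecidableEq m]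
    {A : Matrix n n ℂ} (hA : A.IsHermitian) (e : m ≃ n) :
    vNEntropy (A.submatrix e e) = vNEntropy A := by
  rw [entropy_roots hA, entropy_roots (hA.submatrix e)]
  rw [← Matrix.charpoly_reindex e.symm A]
  rfl

lemma entropy_gram {n m : Type*} [Fintype n] [DecidableEq n] [Fintype m] [DecidableEq m]
    (M : Matrix n m ℂ) :
    vNEntropy (M * Mᴴ) = vNEntropy (Mᵀ * (Mᵀ)ᴴ) := by
  rw [entropy_roots (isHermitian_mul_conjTranspose_self M),
    entropy_roots (isHermitian_mul_conjTranspose_self Mᵀ)]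
  have h1 : Mᵀ * (Mᵀ)ᴴ = (Mᴴ * M)ᵀ := by
    rw [transpose_mul]; rfl
  rw [h1, charpoly_transpose]
  have h2 := congrArg (fun P => (P.roots.map (fun z : ℂ => Real.negMulLog z.re)).sum)
    (charpoly_mul_comm' M Mᴴ)
  have n1 := (charpoly_monic (M * Mᴴ)).ne_zero
  have n2 := (charpoly_monic (Mᴴ * M)).ne_zero
  rw [Polynomial.roots_mul (mul_ne_zero (pow_ne_zero _ Polynomial.X_ne_zero) n1),
    Polynomial.roots_mul (mul_ne_zero (pow_ne_zero _ Polynomial.X_ne_zero) n2)] at h2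
  simpa [Multiset.map_nsmul, Multiset.sum_nsmul] using h2

lemma entropy_nonneg {n : Type*} [Fintype n] [DecidableEq n] {A : Matrix n n ℂ} (hA : A.PosSemidef)
    (htr : A.trace = 1) : 0 ≤ vNEntropy A := by
  obtain ⟨U, p, hU, hU', hp, hA', hS⟩ := spec_psd hA
  have h := trace_spec A U p hU hA'
  rw [htr] at h
  have h1 : ∑ i, p i = 1 := by exact_mod_cast h.symm
  rw [hS]
  refine Finset.sum_nonneg fun i _ => Real.negMulLog_nonneg (hp i) ?_
  rw [← h1]
  exact Finset.single_le_sum (fun j _ => hp j) (Finset.mem_univ i)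

lemma entropy_le_log {n : Type*} [Fintype n] [DecidableEq n] {A : Matrix n n ℂ} (hA : A.PosSemidef)
    (htr : A.trace = 1) : vNEntropy A ≤ Real.log (Fintype.card n) := by
  obtain ⟨U, p, hU, hU', hp, hA', hS⟩ := spec_psd hA
  have h := trace_spec A U p hU hA'
  rw [htr] at h
  have h1 : ∑ i, p i = 1 := by exact_mod_cast h.symm
  rw [hS]
  have hne : Nonempty n := by
    by_contra hc
    rw [not_nonempty_iff] at hc
    simp at h1
  have hc : (0 : ℝ) < Fintype.card n := by exact_mod_cast Fintype.card_pos
  set c : ℝ := ((Fintype.card n : ℕ) : ℝ) with hcdef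
  have h2 : ∀ i, Real.negMulLog (p i) ≤ p i * Real.log c + (1 / c - p i) := by
    intro i
    have h3 := Real.negMulLog_le_one_sub_self (x := p i * c) (by have := hp i; positivity)
    rw [Real.negMulLog_mul] at h3
    have h4 : Real.negMulLog c = - c * Real.log c := rfl
    rw [h4] at h3
    have h5 : Real.negMulLog (p i) = (c * Real.negMulLog (p i)) / c := by field_simp
    rw [h5, div_le_iff₀ hc]
    have : (p i * Real.log c + (1 / c - p i)) * c = p i * c * Real.log c + (1 - p i * c) := by
      field_simp
    rw [this]
    nlinarith
  refine (Finset.sum_le_sum fun i _ => h2 i).trans ?_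
  rw [Finset.sum_add_distrib, ← Finset.sum_mul, h1, Finset.sum_sub_distrib, h1]
  simp only [Finset.sum_const, Finset.card_univ, nsmul_eq_mul]
  rw [← hcdef, one_mul]
  rw [mul_one_div_cancel hc.ne']
  simp

open Kronecker in
lemma kron_spec {m γ : Type*} [Fintype m] [DecidableEq m] [Fintype γ] [DecidableEq γ]
    (A V : Matrix m m ℂ) (q : m → ℝ) (ε : ℝ) (hV : V * Vᴴ = 1)
    (hA : A = V * diagonal (fun i => (q i : ℂ)) * Vᴴ) :
    (A + (ε : ℂ) • (1 : Matrix m m ℂ)) ⊗ₖ (1 : Matrix γ γ ℂ)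
      = (V ⊗ₖ (1 : Matrix γ γ ℂ)) * diagonal (fun x : m × γ => ((q x.1 + ε : ℝ) : ℂ))
        * (V ⊗ₖ (1 : Matrix γ γ ℂ))ᴴ := by
  have h1 : diagonal (fun x : m × γ => ((q x.1 + ε : ℝ) : ℂ)) =
      (diagonal (fun i => (q i : ℂ)) + (ε : ℂ) • (1 : Matrix m m ℂ)) ⊗ₖ (1 : Matrix γ γ ℂ) := by
    rw [← diagonal_one, ← diagonal_one, ← diagonal_smul, diagonal_add, diagonal_kronecker_diagonal]
    congr 1
    ext x
    simp
  rw [h1, conjTranspose_kronecker, ← mul_kronecker_mul, ← mul_kronecker_mul]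
  congr 1
  · rw [Matrix.mul_add, Matrix.add_mul, ← hA]
    simp [hV]
  · simp

open Kronecker in
lemma kron_diag {m γ : Type*} [Fintype m] [DecidableEq m] [Fintype γ] [DecidableEq γ]
    (V : Matrix m m ℂ) (M : Matrix (m × γ) (m × γ) ℂ) (j : m) :
    ∑ c, ((V ⊗ₖ (1 : Matrix γ γ ℂ))ᴴ * M * (V ⊗ₖ (1 : Matrix γ γ ℂ))) (j, c) (j, c)
      = (Vᴴ * (Matrix.of fun x y => ∑ c, M (x, c) (y, c)) * V) j j := by
  rw [conjTranspose_kronecker]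
  simp only [Matrix.mul_apply, Fintype.sum_prod_type, kronecker_apply, conjTranspose_one,
    Matrix.one_apply, Matrix.of_apply, mul_ite, ite_mul, mul_zero, zero_mul, mul_one,
    Finset.sum_ite_eq, Finset.mem_univ, if_true, Finset.sum_mul, Finset.mul_sum]
  rw [Finset.sum_comm]
  refine Finset.sum_congr rfl fun y _ => ?_
  rw [Finset.sum_comm (s := (Finset.univ : Finset m))]
  refine Finset.sum_congr rfl fun c _ => ?_
  rw [Finset.sum_comm]
  refine Finset.sum_congr rfl fun x _ => ?_
  simp

lemma rel_sum {n I J : Type*} [Fintype n] [Fintype I] [Fintype J] [DecidableEq n]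
    [DecidableEq I] [DecidableEq J] (ρ : Matrix n n ℂ)
    (U : Matrix n I ℂ) (V : Matrix n J ℂ) (p : I → ℝ) (q : J → ℝ)
    (hU : Uᴴ * U = 1) (hV' : V * Vᴴ = 1)
    (hρ : ρ = U * diagonal (fun i => (p i : ℂ)) * Uᴴ) :
    ∑ x : J × I, Complex.normSq ((Vᴴ * U) x.1 x.2) *
        (p x.2 * (Real.log (p x.2) - Real.log (q x.1)))
      = - (∑ i, Real.negMulLog (p i)) - ∑ j, ((Vᴴ * ρ * V) j j).re * Real.log (q j) := by
  have h1 : ∀ j, ((Vᴴ * ρ * V) j j).re = ∑ i, Complex.normSq ((Vᴴ * U) j i) * p i := by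
    intro j
    have : Vᴴ * ρ * V = (Vᴴ * U) * diagonal (fun i => (p i : ℂ)) * (Vᴴ * U)ᴴ := by
      rw [hρ, conjTranspose_mul, conjTranspose_conjTranspose]
      simp only [Matrix.mul_assoc]
    rw [this, Matrix.mul_apply, Complex.re_sum]
    refine Finset.sum_congr rfl fun i _ => ?_
    rw [mul_diagonal, conjTranspose_apply]
    generalize (Vᴴ * U) j i = z
    simp [Complex.normSq_apply]; ring
  simp only [h1]
  have h2 : ∑ i, Real.negMulLog (p i)
      = - ∑ x : J × I, Complex.normSq ((Vᴴ * U) x.1 x.2) * (p x.2 * Real.log (p x.2)) := by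
    rw [Fintype.sum_prod_type_right]
    simp only [← Finset.sum_mul, sum_weight U V hU hV', one_mul]
    rw [← Finset.sum_neg_distrib]
    exact Finset.sum_congr rfl fun i _ => by simp [Real.negMulLog]
  rw [h2, neg_neg]
  simp only [Finset.sum_mul]
  rw [← Fintype.sum_prod_type (f := fun x : J × I =>
    Complex.normSq ((Vᴴ * U) x.1 x.2) * p x.2 * Real.log (q x.1)), ← Finset.sum_sub_distrib]
  exact Finset.sum_congr rfl fun x _ => by ring

lemma psd_sum_sub {n m c : Type*} [Fintype c] {M : Matrix n n ℂ}
    (hM : M.PosSemidef) (f : c → m → n) :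
    (Matrix.of fun x y : m => ∑ k, M (f k x) (f k y)).PosSemidef := by
  have h := Matrix.posSemidef_sum (Finset.univ : Finset c) (fun k _ => hM.submatrix (f k))
  convert h using 1
  ext x y
  simp [Matrix.sum_apply]

lemma lim_eps {m : Type*} [Fintype m] (q : m → ℝ) (k : ℝ) :
    Filter.Tendsto (fun ε : ℝ => ∑ j, q j * Real.log (q j + k * ε)) (nhdsWithin 0 (Set.Ioi 0))
      (nhds (- ∑ j, Real.negMulLog (q j))) := by
  rw [← Finset.sum_neg_distrib]
  refine tendsto_finsetSum _ fun j _ => ?_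
  by_cases h : q j = 0
  · simp [h]
  have h1 : Filter.Tendsto (fun ε : ℝ => q j + k * ε) (nhdsWithin 0 (Set.Ioi 0)) (nhds (q j)) := by
    have : Continuous (fun ε : ℝ => q j + k * ε) := by fun_prop
    have h2 := this.tendsto 0
    simp only [mul_zero, add_zero] at h2
    exact h2.mono_left nhdsWithin_le_nhds
  have h3 := (h1.log h).const_mul (q j)
  convert h3 using 2
  simp [Real.negMulLog]

open Kronecker in
/-- strong subadditivity -/
lemma ssa_s12 {α β γ : Type*} [Fintype α] [Fintype β] [Fintype γ] [DecidableEq α] [DecidableEq β]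
    [DecidableEq γ] [Nonempty α] (P : Matrix (α × β × γ) (α × β × γ) ℂ) (hP : P.PosSemidef) :
    vNEntropy P + vNEntropy (Matrix.of fun b b' : β => ∑ x : α × γ, P (x.1, b, x.2) (x.1, b', x.2))
      ≤ vNEntropy (Matrix.of fun x y : α × β => ∑ c : γ, P (x.1, x.2, c) (y.1, y.2, c))
        + vNEntropy (Matrix.of fun x y : β × γ => ∑ a : α, P (a, x) (a, y)) := by
  set A := (Matrix.of fun x y : α × β => ∑ c : γ, P (x.1, x.2, c) (y.1, y.2, c)) with hA
  set B := (Matrix.of fun b b' : β => ∑ x : α × γ, P (x.1, b, x.2) (x.1, b', x.2)) with hB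
  have hApsd : A.PosSemidef := psd_sum_sub hP (fun c (x : α × β) => (x.1, x.2, c))
  have hBpsd : B.PosSemidef := psd_sum_sub hP (fun (x : α × γ) (b : β) => (x.1, b, x.2))
  have hCpsd : (pt1 P).PosSemidef := psd_sum_sub hP (fun (a : α) (x : β × γ) => (a, x))
  change _ ≤ _ + vNEntropy (pt1 P)
  obtain ⟨U, p, hU, hU', hp, hρ, hS⟩ := spec_psd hP
  obtain ⟨U₁, p₁, hU₁, hU₁', hp₁, hρ₁, hS₁⟩ := spec_psd hCpsd
  obtain ⟨V, q, hV, hV', hq, hσ, hS₂⟩ := spec_psd hApsd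
  obtain ⟨V₁, q₁, hV₁, hV₁', hq₁, hσ₁, hS₃⟩ := spec_psd hBpsd
  let e : (α × β) × γ ≃ α × β × γ := Equiv.prodAssoc α β γ
  let VV : Matrix (α × β × γ) ((α × β) × γ) ℂ := (V ⊗ₖ (1 : Matrix γ γ ℂ)).submatrix e.symm id
  let WW : Matrix (β × γ) (β × γ) ℂ := V₁ ⊗ₖ (1 : Matrix γ γ ℂ)
  have kV : (V ⊗ₖ (1 : Matrix γ γ ℂ))ᴴ * (V ⊗ₖ (1 : Matrix γ γ ℂ)) = 1 := by
    rw [conjTranspose_kronecker, ← mul_kronecker_mul, hV]; simp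
  have kV' : (V ⊗ₖ (1 : Matrix γ γ ℂ)) * (V ⊗ₖ (1 : Matrix γ γ ℂ))ᴴ = 1 := by
    rw [conjTranspose_kronecker, ← mul_kronecker_mul, hV']; simp
  have hWW : WWᴴ * WW = 1 := by
    simp only [WW]
    rw [conjTranspose_kronecker, ← mul_kronecker_mul, hV₁]; simp
  have hWW' : WW * WWᴴ = 1 := by
    simp only [WW]
    rw [conjTranspose_kronecker, ← mul_kronecker_mul, hV₁']; simp
  have hVV : VVᴴ * VV = 1 := by
    simp only [VV, conjTranspose_submatrix]
    rw [submatrix_mul_equiv, kV]; simp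
  have hVV' : VV * VVᴴ = 1 := by
    simp only [VV, conjTranspose_submatrix]
    rw [← submatrix_mul _ _ _ _ _ Function.bijective_id, kV']; simp
  have main : ∀ ε : ℝ, 0 < ε →
      - (∑ i, Real.negMulLog (p₁ i)) - ∑ j, q₁ j * Real.log (q₁ j + Fintype.card α * ε)
      ≤ - (∑ i, Real.negMulLog (p i)) - ∑ j, q j * Real.log (q j + 1 * ε) := by
    intro ε hε
    have hcard : (0 : ℝ) < Fintype.card α := by exact_mod_cast Fintype.card_pos
    have k1 := kron_spec (γ := γ) A V q ε hV' hσ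
    have k2 := kron_spec (γ := γ) B V₁ q₁ (Fintype.card α * ε) hV₁' hσ₁
    have hs1 : ((A + (ε : ℂ) • (1 : Matrix _ _ ℂ)) ⊗ₖ (1 : Matrix γ γ ℂ)).submatrix e.symm e.symm
        = VV * diagonal (fun x : (α × β) × γ => ((q x.1 + ε : ℝ) : ℂ)) * VVᴴ := by
      rw [k1]
      simp only [VV, conjTranspose_submatrix]
      rw [submatrix_mul _ _ _ _ _ Function.bijective_id, submatrix_mul _ _ _ _ _ Function.bijective_id]
      simp
    have hs2 : pt1 (((A + (ε : ℂ) • (1 : Matrix _ _ ℂ)) ⊗ₖ (1 : Matrix γ γ ℂ)).submatrix e.symm e.symm)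
        = WW * diagonal (fun x : β × γ => ((q₁ x.1 + Fintype.card α * ε : ℝ) : ℂ)) * WWᴴ := by
      simp only [WW]
      rw [← k2]
      ext x y
      obtain ⟨b, c⟩ := x
      obtain ⟨b', c'⟩ := y
      simp only [pt1, Matrix.of_apply, submatrix_apply, e, Equiv.prodAssoc_symm_apply, kronecker_apply,
        Matrix.add_apply, Matrix.smul_apply, Matrix.one_apply, hA, hB, Fintype.sum_prod_type,
        ← Finset.sum_mul, Finset.sum_add_distrib, Prod.mk.injEq, true_and, Finset.sum_const,
        Finset.card_univ]
      congr 2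
      simp
    have h := rel_mono P _ U VV p (fun x => q x.1 + ε) hU hVV hU' hVV' hρ hs1 hp
      (fun x => by have := hq x.1; positivity) U₁ WW p₁ (fun x => q₁ x.1 + Fintype.card α * ε) hU₁ hWW hWW'
      hρ₁ hs2 hp₁ (fun x => by have := hq₁ x.1; positivity)
    have r1 := rel_sum P U VV p (fun x => q x.1 + ε) hU hVV' hρ
    have r2 := rel_sum (pt1 P) U₁ WW p₁ (fun x => q₁ x.1 + Fintype.card α * ε) hU₁ hWW' hρ₁
    beta_reduce at r1 r2
    rw [r1, r2] at h
    have g1 : ∀ j, ∑ c, ((VVᴴ * P * VV) (j, c) (j, c)).re = q j := by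
      intro j
      have : VVᴴ * P * VV = (V ⊗ₖ (1 : Matrix γ γ ℂ))ᴴ * P.submatrix e e * (V ⊗ₖ (1 : Matrix γ γ ℂ)) := by
        simp only [VV, conjTranspose_submatrix]
        have : P = (P.submatrix e e).submatrix e.symm e.symm := by simp
        conv_lhs => rw [this]
        rw [submatrix_mul_equiv, submatrix_mul_equiv]
        simp
      rw [this, ← Complex.re_sum, kron_diag]
      have h3 : (Matrix.of fun x y => ∑ c, P.submatrix e e (x, c) (y, c)) = A := rfl
      rw [h3, hσ, show Vᴴ * (V * diagonal (fun i => (q i : ℂ)) * Vᴴ) * V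
        = (Vᴴ * V) * diagonal (fun i => (q i : ℂ)) * (Vᴴ * V) by simp only [Matrix.mul_assoc], hV]
      simp
    have g2 : ∀ j, ∑ c, ((WWᴴ * pt1 P * WW) (j, c) (j, c)).re = q₁ j := by
      intro j
      simp only [WW]
      rw [← Complex.re_sum, kron_diag]
      have h3 : (Matrix.of fun x y => ∑ c, pt1 P (x, c) (y, c)) = B := by
        ext x y
        simp only [pt1, hB, Matrix.of_apply]
        rw [Fintype.sum_prod_type_right]
      rw [h3, hσ₁, show V₁ᴴ * (V₁ * diagonal (fun i => (q₁ i : ℂ)) * V₁ᴴ) * V₁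
        = (V₁ᴴ * V₁) * diagonal (fun i => (q₁ i : ℂ)) * (V₁ᴴ * V₁) by simp only [Matrix.mul_assoc], hV₁]
      simp
    rw [Fintype.sum_prod_type (f := fun j => ((VVᴴ * P * VV) j j).re * Real.log (q j.1 + ε)),
      Fintype.sum_prod_type (f := fun j => ((WWᴴ * pt1 P * WW) j j).re *
        Real.log (q₁ j.1 + Fintype.card α * ε))] at h
    simp only [← Finset.sum_mul, g1, g2] at h
    simpa only [one_mul] using h
  have L1 := (lim_eps q₁ (Fintype.card α)).const_sub (- (∑ i, Real.negMulLog (p₁ i)))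
  have L2 := (lim_eps q 1).const_sub (- (∑ i, Real.negMulLog (p i)))
  have := le_of_tendsto_of_tendsto L1 L2 (by
    filter_upwards [self_mem_nhdsWithin] with ε hε using main ε hε)
  rw [hS, hS₁, hS₂, hS₃]
  linarith

lemma pure_of_rank {n : Type*} [Fintype n] [DecidableEq n] {ρ : Matrix n n ℂ} (hρ : ρ.PosSemidef)
    (hrank : ρ.rank = 1) : ∃ ψ : n → ℂ, ∀ x y, ρ x y = ψ x * star (ψ y) := by
  have h1 := hρ.1.rank_eq_card_non_zero_eigs
  rw [hrank] at h1
  obtain ⟨⟨k, hk⟩, huniq⟩ := Fintype.card_eq_one_iff.1 h1.symm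
  have hz : ∀ i, i ≠ k → hρ.1.eigenvalues i = 0 := by
    intro i hi
    by_contra hc
    exact hi (congrArg Subtype.val (huniq ⟨i, hc⟩))
  refine ⟨fun x => (hρ.1.eigenvectorUnitary : Matrix n n ℂ) x k * (Real.sqrt (hρ.1.eigenvalues k) : ℂ), ?_⟩
  intro x y
  have hs : ρ = (hρ.1.eigenvectorUnitary : Matrix n n ℂ) *
      diagonal (fun i => (hρ.1.eigenvalues i : ℂ)) * (hρ.1.eigenvectorUnitary : Matrix n n ℂ)ᴴ :=
    hρ.1.spectral_theorem
  generalize (hρ.1.eigenvectorUnitary : Matrix n n ℂ) = U at hs ⊢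
  have hnn := hρ.eigenvalues_nonneg k
  generalize hρ.1.eigenvalues = lam at hs hz hnn ⊢
  rw [hs, Matrix.mul_apply, Finset.sum_eq_single k]
  · have h2 : ((Real.sqrt (lam k) : ℂ)) * (Real.sqrt (lam k) : ℂ) = (lam k : ℂ) := by
      rw [← Complex.ofReal_mul, Real.mul_self_sqrt hnn]
    rw [mul_diagonal, conjTranspose_apply, ← h2]
    simp
    ring
  · intro i _ hi
    rw [mul_diagonal, hz i hi]; simp
  · simp

lemma ptrace_entropy {N d : ℕ} {κ τ : Type*} [Fintype κ] [Fintype τ] [DecidableEq κ] [DecidableEq τ]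
    [Nonempty κ] [Nonempty τ]
    (ρ : Matrix (Fin N → Fin d) (Fin N → Fin d) ℂ) (ψ : (Fin N → Fin d) → ℂ)
    (hψ : ∀ x y, ρ x y = ψ x * star (ψ y)) (T : Finset (Fin N))
    (G : κ → τ → Fin N → Fin d) (hG : Function.Bijective (fun p : κ × τ => G p.1 p.2))
    (h1 : ∀ x z z' i, i ∉ T → G x z i = G x z' i)
    (h2 : ∀ x x' z i, i ∈ T → G x z i = G x' z i) :
    vNEntropy (ptrace T ρ) = vNEntropy (Matrix.of fun x y : κ => ∑ z, ψ (G x z) * star (ψ (G y z))) ∧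
    vNEntropy (ptrace T ρ) = vNEntropy (Matrix.of fun z w : τ => ∑ x, ψ (G x z) * star (ψ (G x w))) := by
  obtain ⟨x0⟩ := ‹Nonempty κ›
  obtain ⟨z0⟩ := ‹Nonempty τ›
  let u : κ → ({i : Fin N // i ∉ T} → Fin d) := fun x i => G x z0 i
  let v : τ → ({i : Fin N // i ∈ T} → Fin d) := fun z i => G x0 z i
  have hm : ∀ x z, mergeOn T (u x) (v z) = G x z := by
    intro x z
    funext i
    unfold mergeOn
    split_ifs with h
    · exact h2 _ _ _ _ h
    · exact h1 _ _ _ _ h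
  have hu : Function.Bijective u := by
    constructor
    · intro x x' h
      have : G x z0 = G x' z0 := by rw [← hm, ← hm, h]
      exact congrArg Prod.fst (@hG.1 (x, z0) (x', z0) this)
    · intro a
      obtain ⟨⟨x, z⟩, hx⟩ := hG.2 (mergeOn T a (v z0))
      refine ⟨x, ?_⟩
      funext ⟨i, hi⟩
      have := congrFun hx i
      simp only [mergeOn, hi, dite_false] at this
      rw [← this]
      exact h1 _ _ _ _ hi
  have hv : Function.Bijective v := by
    constructor
    · intro x x' h
      have : G x0 x = G x0 x' := by rw [← hm, ← hm, h]
      exact congrArg Prod.snd (@hG.1 (x0, x) (x0, x') this)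
    · intro a
      obtain ⟨⟨x, z⟩, hx⟩ := hG.2 (mergeOn T (u x0) a)
      refine ⟨z, ?_⟩
      funext ⟨i, hi⟩
      have := congrFun hx i
      simp only [mergeOn, hi, dite_true] at this
      rw [← this]
      exact h2 _ _ _ _ hi
  let M : Matrix κ τ ℂ := Matrix.of fun x z => ψ (G x z)
  have e1 : (Matrix.of fun x y : κ => ∑ z, ψ (G x z) * star (ψ (G y z))) = M * Mᴴ := by
    ext x y; simp [M, Matrix.mul_apply]
  have e2 : (Matrix.of fun z w : τ => ∑ x, ψ (G x z) * star (ψ (G x w))) = Mᵀ * (Mᵀ)ᴴ := by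
    ext x y; simp [M, Matrix.mul_apply]
  have e3 : (ptrace T ρ) = (M * Mᴴ).submatrix (Equiv.ofBijective u hu).symm (Equiv.ofBijective u hu).symm := by
    rw [← e1]
    ext a b
    obtain ⟨x, rfl⟩ := hu.2 a
    obtain ⟨y, rfl⟩ := hu.2 b
    have t : ∀ x, (Equiv.ofBijective u hu).symm (u x) = x := fun x =>
      (Equiv.ofBijective u hu).symm_apply_apply x
    simp only [ptrace, Matrix.of_apply, submatrix_apply, t]
    symm
    refine Fintype.sum_bijective v hv _ _ fun z => ?_
    rw [hm, hm, hψ]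
  rw [e1, e2, ← entropy_gram, e3, entropy_reindex (isHermitian_mul_conjTranspose_self M)]
  exact ⟨rfl, rfl⟩

/-- assemble a configuration from its values at `i`, `k`, elsewhere, and at `j` -/
def asm {N d : ℕ} (i j k : Fin N) (a b : Fin d)
    (c : {x : Fin N // x ≠ i ∧ x ≠ k ∧ x ≠ j} → Fin d) (z : Fin d) : Fin N → Fin d :=
  fun x => if h1 : x = i then a else if h2 : x = k then b else if h3 : x = j then z
    else c ⟨x, h1, h2, h3⟩

lemma asm_bij {N d : ℕ} (i j k : Fin N) (hij : i ≠ j) (hik : i ≠ k) (hjk : j ≠ k) :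
    Function.Bijective (fun p : (Fin d × Fin d × ({x : Fin N // x ≠ i ∧ x ≠ k ∧ x ≠ j} → Fin d)) × Fin d =>
      asm i j k p.1.1 p.1.2.1 p.1.2.2 p.2) := by
  constructor
  · rintro ⟨⟨a, b, c⟩, z⟩ ⟨⟨a', b', c'⟩, z'⟩ h
    simp only at h
    have ha := congrFun h i
    have hb := congrFun h k
    have hz := congrFun h j
    simp [asm] at ha
    simp [asm, hik.symm] at hb
    simp [asm, hij.symm, hjk] at hz
    have hc : c = c' := by
      funext ⟨x, h1, h2, h3⟩
      have := congrFun h x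
      simpa [asm, h1, h2, h3] using this
    subst ha hb hz hc
    rfl
  · intro f
    refine ⟨⟨⟨f i, f k, fun x => f x⟩, f j⟩, ?_⟩
    funext x
    simp only [asm]
    split_ifs with h1 h2 h3
    · rw [h1]
    · rw [h2]
    · rw [h3]
    · rfl

lemma entropy_bounds {N d : ℕ} (ρ : Matrix (Fin N → Fin d) (Fin N → Fin d) ℂ)
    (ψ : (Fin N → Fin d) → ℂ) (hψ : ∀ x y, ρ x y = ψ x * star (ψ y)) (htr : ρ.trace = 1)
    (i j k : Fin N) (hij : i ≠ j) (hik : i ≠ k) (hjk : j ≠ k) [Nonempty (Fin d)] :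
    vNEntropy (ptrace {i} ρ) ≤ Real.log d ∧
    vNEntropy (ptrace {j} ρ) + vNEntropy (ptrace {k} ρ)
      ≤ vNEntropy (ptrace {i, k} ρ) + vNEntropy (ptrace {i, j} ρ) := by
  set R := {x : Fin N // x ≠ i ∧ x ≠ k ∧ x ≠ j} → Fin d with hR
  have hb := asm_bij (d := d) i j k hij hik hjk
  let P : Matrix (Fin d × Fin d × R) (Fin d × Fin d × R) ℂ := Matrix.of fun x y =>
    ∑ z, ψ (asm i j k x.1 x.2.1 x.2.2 z) * star (ψ (asm i j k y.1 y.2.1 y.2.2 z))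
  have hP : P.PosSemidef := by
    let M : Matrix (Fin d × Fin d × R) (Fin d) ℂ := Matrix.of fun x z =>
      ψ (asm i j k x.1 x.2.1 x.2.2 z)
    have : P = M * Mᴴ := by
      ext x y; simp [P, M, Matrix.mul_apply]
    rw [this]
    exact posSemidef_self_mul_conjTranspose M
  have hssa := ssa_s12 P hP
  have tj := (ptrace_entropy ρ ψ hψ {j}
    (fun (x : Fin d × Fin d × R) (z : Fin d) => asm i j k x.1 x.2.1 x.2.2 z) hb
    (by intro x z z' y hy; rw [Finset.mem_singleton] at hy; simp [asm, hy])
    (by intro x x' z y hy; rw [Finset.mem_singleton] at hy; subst hy; simp [asm, hij.symm, hjk])).1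
  have tij := (ptrace_entropy ρ ψ hψ {i, j}
    (fun (x : Fin d × R) (z : Fin d × Fin d) => asm i j k z.1 x.1 x.2 z.2)
    (hb.comp (f := fun p : (Fin d × R) × (Fin d × Fin d) => ((p.2.1, p.1.1, p.1.2), p.2.2))
      (Function.bijective_iff_has_inverse.2 ⟨fun p => ((p.1.2.1, p.1.2.2), (p.1.1, p.2)),
        fun _ => rfl, fun _ => rfl⟩))
    (by intro x z z' y hy; simp at hy; simp [asm, hy])
    (by intro x x' z y hy; simp at hy; rcases hy with rfl | rfl <;> simp [asm, hij.symm, hjk])).1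
  have tk := (ptrace_entropy ρ ψ hψ {k}
    (fun (x : (Fin d × R) × Fin d) (z : Fin d) => asm i j k x.1.1 z x.1.2 x.2)
    (hb.comp (f := fun p : ((Fin d × R) × Fin d) × Fin d => ((p.1.1.1, p.2, p.1.1.2), p.1.2))
      (Function.bijective_iff_has_inverse.2 ⟨fun p => (((p.1.1, p.1.2.2), p.2), p.1.2.1),
        fun _ => rfl, fun _ => rfl⟩))
    (by intro x z z' y hy; simp at hy; simp [asm, hy])
    (by intro x x' z y hy; simp at hy; subst hy; simp [asm, hik.symm])).2
  have tik := (ptrace_entropy ρ ψ hψ {i, k}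
    (fun (x : R × Fin d) (z : Fin d × Fin d) => asm i j k z.1 z.2 x.1 x.2)
    (hb.comp (f := fun p : (R × Fin d) × (Fin d × Fin d) => ((p.2.1, p.2.2, p.1.1), p.1.2))
      (Function.bijective_iff_has_inverse.2 ⟨fun p => ((p.1.2.2, p.2), (p.1.1, p.1.2.1)),
        fun _ => rfl, fun _ => rfl⟩))
    (by intro x z z' y hy; simp at hy; simp [asm, hy])
    (by intro x x' z y hy; simp at hy; rcases hy with rfl | rfl <;> simp [asm, hik.symm])).2
  have hbi : Function.Bijective (fun p : (Fin d × R × Fin d) × Fin d =>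
      asm i j k p.2 p.1.1 p.1.2.1 p.1.2.2) :=
    hb.comp (f := fun p : (Fin d × R × Fin d) × Fin d => ((p.2, p.1.1, p.1.2.1), p.1.2.2))
      (Function.bijective_iff_has_inverse.2 ⟨fun p => ((p.1.2.1, p.1.2.2, p.2), p.1.1),
        fun _ => rfl, fun _ => rfl⟩)
  have ti := (ptrace_entropy ρ ψ hψ {i}
    (fun (x : Fin d × R × Fin d) (z : Fin d) => asm i j k z x.1 x.2.1 x.2.2) hbi
    (by intro x z z' y hy; simp at hy; simp [asm, hy])
    (by intro x x' z y hy; simp at hy; subst hy; simp [asm])).2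
  constructor
  · rw [ti]
    have h := entropy_le_log (A := Matrix.of fun z w : Fin d => ∑ x : Fin d × R × Fin d,
      ψ (asm i j k z x.1 x.2.1 x.2.2) * star (ψ (asm i j k w x.1 x.2.1 x.2.2))) ?_ ?_
    · simpa using h
    · let M : Matrix (Fin d) (Fin d × R × Fin d) ℂ := Matrix.of fun z x =>
        ψ (asm i j k z x.1 x.2.1 x.2.2)
      convert posSemidef_self_mul_conjTranspose M using 1
      ext x y; simp [M, Matrix.mul_apply]
    · rw [← htr]
      simp only [trace, diag, Matrix.of_apply]
      rw [← Fintype.sum_prod_type_right (f := fun p : (Fin d × R × Fin d) × Fin d =>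
        ψ (asm i j k p.2 p.1.1 p.1.2.1 p.1.2.2) * star (ψ (asm i j k p.2 p.1.1 p.1.2.1 p.1.2.2)))]
      exact Fintype.sum_bijective _ hbi _ _ fun p => (hψ _ _).symm
  · have e1 : vNEntropy (ptrace {j} ρ) = vNEntropy P := tj
    have e2 : vNEntropy (ptrace {i, j} ρ) =
        vNEntropy (Matrix.of fun x y : Fin d × R => ∑ a, P (a, x) (a, y)) := by
      rw [tij]
      congr 1
      ext x y
      simp only [Matrix.of_apply, P, Fintype.sum_prod_type]
    have e3 : vNEntropy (ptrace {k} ρ) =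
        vNEntropy (Matrix.of fun b b' => ∑ x : Fin d × R, P (x.1, b, x.2) (x.1, b', x.2)) := by
      rw [tk]
      congr 1
      ext x y
      simp only [Matrix.of_apply, P]
      rw [Fintype.sum_prod_type]
    have e4 : vNEntropy (ptrace {i, k} ρ) =
        vNEntropy (Matrix.of fun x y : Fin d × Fin d => ∑ c : R, P (x.1, x.2, c) (y.1, y.2, c)) := by
      rw [tik]
      congr 1
      ext x y
      simp only [Matrix.of_apply, P]
      rw [Fintype.sum_prod_type]
    rw [e1, e2, e3, e4]
    exact hssa

/-- for every rank-one (pure) `N`-partite density matrix `ρ` of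
local dimension `d` with `N ≥ 3`, the `N`-partite dependence satisfies
`D_N(ρ) ≤ log d`. -/
theorem stmt_12 {N d : ℕ} (hN : 3 ≤ N)
    (ρ : Matrix (Fin N → Fin d) (Fin N → Fin d) ℂ)
    (hρ : ρ.PosSemidef) (htr : ρ.trace = 1) (hrank : ρ.rank = 1) :
    depQ ρ ≤ Real.log d := by
  obtain ⟨ψ, hψ⟩ := pure_of_rank hρ hrank
  let i : Fin N := ⟨0, by omega⟩
  let j : Fin N := ⟨1, by omega⟩
  let k : Fin N := ⟨2, by omega⟩
  have hij : i ≠ j := by simp [i, j]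
  have hik : i ≠ k := by simp [i, k]
  have hjk : j ≠ k := by simp [j, k]
  have hne : Nonempty (Fin d) := by
    by_contra hc
    rw [not_nonempty_iff] at hc
    have : IsEmpty (Fin N → Fin d) := ⟨fun f => hc.elim (f i)⟩
    simp [trace] at htr
  obtain ⟨hb1, hb2⟩ := entropy_bounds ρ ψ hψ htr i j k hij hik hjk
  have h0 := entropy_nonneg hρ htr
  have hbdd : BddBelow {x | ∃ i j : Fin N, i ≠ j ∧
    x = vNEntropy (ptrace {i} ρ) + vNEntropy (ptrace {j} ρ)
        - vNEntropy (ptrace {i, j} ρ) - vNEntropy ρ} := by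
    apply Set.Finite.bddBelow
    refine (Set.finite_range (fun p : Fin N × Fin N =>
      vNEntropy (ptrace {p.1} ρ) + vNEntropy (ptrace {p.2} ρ)
        - vNEntropy (ptrace {p.1, p.2} ρ) - vNEntropy ρ)).subset ?_
    rintro x ⟨i, j, _, rfl⟩
    exact ⟨(i, j), rfl⟩
  have l1 : depQ ρ ≤ vNEntropy (ptrace {i} ρ) + vNEntropy (ptrace {j} ρ)
        - vNEntropy (ptrace {i, j} ρ) - vNEntropy ρ := csInf_le hbdd ⟨i, j, hij, rfl⟩
  have l2 : depQ ρ ≤ vNEntropy (ptrace {i} ρ) + vNEntropy (ptrace {k} ρ)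
        - vNEntropy (ptrace {i, k} ρ) - vNEntropy ρ := csInf_le hbdd ⟨i, k, hik, rfl⟩
  linarith
end

section
/- Let N ≥ 3, d ≥ 2, and let |GHZ⟩ = d^{−1/2} Σ_{k=0}^{d−1} |k⟩^{⊗N} be the N-qudit GHZ state, with ρ = |GHZ⟩⟨GHZ|. Then D_N(ρ) = log d; i.e., the GHZ state attains the maximal dependence among pure states. -/
open Matrix ComplexOrder

/-- The density matrix `|GHZ⟩⟨GHZ|` of the `N`-qudit GHZ state
`|GHZ⟩ = d^{−1/2} Σ_k |k⟩^{⊗N}`: the state vector has entry `d^{−1/2}` at each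
constant configuration `(k,…,k)` and `0` elsewhere. -/
noncomputable def ghzMat (N d : ℕ) : Matrix (Fin N → Fin d) (Fin N → Fin d) ℂ :=
  Matrix.of fun x y =>
    (if ∀ i j : Fin N, x i = x j then ((1 / Real.sqrt d : ℝ) : ℂ) else 0) *
    (if ∀ i j : Fin N, y i = y j then ((1 / Real.sqrt d : ℝ) : ℂ) else 0)

lemma vN_of_sq {n : Type*} [Fintype n] [DecidableEq n]
    (A : Matrix n n ℂ) (h : A.IsHermitian) (c : ℝ) (hc : A * A = (c : ℂ) • A)
    (ht : A.trace = 1) : vNEntropy A = - Real.log c := by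
  have key : ∀ i, h.eigenvalues i = 0 ∨ h.eigenvalues i = c := by
    intro i
    have h1 := h.mulVec_eigenvectorBasis i
    set v : n → ℂ := ⇑(h.eigenvectorBasis i) with hv
    have hv0 : v ≠ 0 := by
      intro h0
      apply h.eigenvectorBasis.orthonormal.ne_zero i
      ext j
      exact congrFun h0 j
    have h2 : (A * A) *ᵥ v = (c : ℂ) • (A *ᵥ v) := by
      rw [hc, Matrix.smul_mulVec]
    rw [← Matrix.mulVec_mulVec, h1, Matrix.mulVec_smul, h1] at h2
    obtain ⟨j, hj⟩ := Function.ne_iff.mp hv0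
    have h3 := congrFun h2 j
    simp only [Pi.smul_apply, Complex.real_smul, smul_eq_mul, Pi.zero_apply] at h3 hj
    have h4 : ((h.eigenvalues i : ℝ) : ℂ) * ((h.eigenvalues i : ℝ) : ℂ)
        = (c : ℂ) * ((h.eigenvalues i : ℝ) : ℂ) := by
      apply mul_right_cancel₀ hj
      linear_combination h3
    have h5 : h.eigenvalues i * h.eigenvalues i = c * h.eigenvalues i := by exact_mod_cast h4
    have h6 : h.eigenvalues i * (h.eigenvalues i - c) = 0 := by linarith
    rcases mul_eq_zero.mp h6 with h7 | h7
    · exact Or.inl h7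
    · exact Or.inr (by linarith)
  have hsum : ∑ i, h.eigenvalues i = 1 := by
    have := h.trace_eq_sum_eigenvalues
    rw [ht] at this
    have h8 : ((∑ i, h.eigenvalues i : ℝ) : ℂ) = 1 := by
      rw [this]; push_cast; rfl
    exact_mod_cast h8
  rw [vNEntropy, dif_pos h]
  calc ∑ i, Real.negMulLog (h.eigenvalues i) = ∑ i, h.eigenvalues i * (- Real.log c) := by
        refine Finset.sum_congr rfl fun i _ => ?_
        rcases key i with h0 | h0 <;> rw [h0] <;> simp [Real.negMulLog]
    _ = - Real.log c := by rw [← Finset.sum_mul, hsum, one_mul]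

lemma sum_const {ι : Type*} [Fintype ι] [DecidableEq ι] [Nonempty ι] {d : ℕ} (z : ℂ)
    [DecidablePred fun a : ι → Fin d => ∀ i j, a i = a j] :
    ∑ a : ι → Fin d, (if ∀ i j, a i = a j then z else 0) = d * z := by
  rw [← Finset.sum_filter]
  have : (Finset.univ.filter fun a : ι → Fin d => ∀ i j, a i = a j)
      = Finset.univ.image (fun k : Fin d => fun _ : ι => k) := by
    ext a
    simp only [Finset.mem_filter, Finset.mem_univ, true_and, Finset.mem_image]
    constructor
    · intro h
      exact ⟨a (Classical.arbitrary ι), funext fun i => h _ _⟩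
    · rintro ⟨k, rfl⟩ i j
      rfl
  rw [this, Finset.sum_const, Finset.card_image_of_injective]
  · simp
  · intro k l h
    exact congrFun h (Classical.arbitrary ι)

lemma sq_d {d : ℕ} (hd : 2 ≤ d) :
    ((1 / Real.sqrt d : ℝ) : ℂ) * ((1 / Real.sqrt d : ℝ) : ℂ) = (d : ℂ)⁻¹ := by
  rw [← Complex.ofReal_mul, div_mul_div_comm, Real.mul_self_sqrt (by positivity)]
  simp

lemma ghz_entropy {N d : ℕ} (hN : 3 ≤ N) (hd : 2 ≤ d) : vNEntropy (ghzMat N d) = 0 := by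
  have : Nonempty (Fin N) := ⟨⟨0, by omega⟩⟩
  have hd0 : (d : ℂ) ≠ 0 := by exact_mod_cast (by omega : d ≠ 0)
  have hs : ∑ y : Fin N → Fin d, ghzMat N d y y = 1 := by
    have : ∀ y : Fin N → Fin d, ghzMat N d y y
        = if ∀ i j, y i = y j then (d : ℂ)⁻¹ else 0 := by
      intro y
      simp only [ghzMat, Matrix.of_apply]
      split_ifs
      · exact sq_d hd
      · simp
    simp_rw [this]
    rw [sum_const, mul_inv_cancel₀ hd0]
  rw [vN_of_sq (ghzMat N d) ?_ 1 ?_ hs]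
  · simp
  · ext x y
    simp only [ghzMat, Matrix.conjTranspose_apply, Matrix.of_apply, star_mul']
    split_ifs <;> simp
  · ext x y
    rw [Matrix.mul_apply]
    have : ∀ z, ghzMat N d x z * ghzMat N d z y = ghzMat N d x y * ghzMat N d z z := by
      intro z
      simp only [ghzMat, Matrix.of_apply]
      ring
    simp_rw [this]
    rw [← Finset.mul_sum, hs]
    simp

lemma merge_const {N d : ℕ} (T : Finset (Fin N)) (a : {i : Fin N // i ∉ T} → Fin d)
    (c : {i : Fin N // i ∈ T} → Fin d) (p : {i : Fin N // i ∉ T}) :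
    (∀ i j, mergeOn T a c i = mergeOn T a c j) ↔
      (∀ i j, a i = a j) ∧ c = fun _ => a p := by
  constructor
  · intro h
    constructor
    · intro i j
      have := h i j
      simpa [mergeOn, i.2, j.2] using this
    · funext i
      have := h i p
      simpa [mergeOn, i.2, p.2] using this
  · rintro ⟨h, rfl⟩
    have : ∀ i, mergeOn T a (fun _ => a p) i = a p := by
      intro i
      unfold mergeOn
      split_ifs
      · rfl
      · exact h _ _
    intro i j
    rw [this, this]

lemma ptrace_ghz {N d : ℕ} (hd : 2 ≤ d) (T : Finset (Fin N)) (p : {i : Fin N // i ∉ T})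
    (q : {i : Fin N // i ∈ T}) :
    ptrace T (ghzMat N d) = Matrix.diagonal
      fun a => if ∀ i j, a i = a j then (d : ℂ)⁻¹ else 0 := by
  ext a b
  simp only [ptrace, ghzMat, Matrix.of_apply, merge_const T _ _ p, Matrix.diagonal_apply]
  by_cases ha : ∀ i j, a i = a j
  · rw [Finset.sum_eq_single (fun _ => a p)]
    · by_cases hab : a = b
      · subst hab
        rw [if_pos ⟨ha, rfl⟩, if_pos rfl, if_pos ha]
        exact sq_d hd
      · have : ¬ ((∀ i j, b i = b j) ∧
            (fun _ : {i : Fin N // i ∈ T} => a p) = fun _ => b p) := by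
          rintro ⟨hb, h2⟩
          apply hab
          funext i
          rw [ha i p, hb i p]
          exact congrFun h2 q
        rw [if_neg this, if_neg hab, mul_zero]
    · intro c _ hc
      rw [if_neg (fun h => hc h.2), zero_mul]
    · intro h
      exact absurd (Finset.mem_univ _) h
  · rw [Finset.sum_eq_zero]
    · rw [if_neg ha, ite_self]
    · intro c _
      rw [if_neg (fun h => ha h.1), zero_mul]

lemma ptrace_entropy_s13 {N d : ℕ} (hd : 2 ≤ d) (T : Finset (Fin N)) (p : {i : Fin N // i ∉ T})
    (q : {i : Fin N // i ∈ T}) :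
    vNEntropy (ptrace T (ghzMat N d)) = Real.log d := by
  have : Nonempty {i : Fin N // i ∉ T} := ⟨p⟩
  have hd0 : (d : ℂ) ≠ 0 := by exact_mod_cast (by omega : d ≠ 0)
  rw [ptrace_ghz hd T p q, vN_of_sq _ ?_ ((d : ℝ)⁻¹) ?_ ?_]
  · simp
  · rw [Matrix.IsHermitian, Matrix.diagonal_conjTranspose]
    congr 1
    funext a
    simp only [Pi.star_apply]
    split_ifs <;> simp
  · rw [Matrix.diagonal_mul_diagonal, ← Matrix.diagonal_smul]
    congr 1
    funext a
    simp only [Pi.smul_apply]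
    split_ifs <;> simp
  · rw [Matrix.trace_diagonal, sum_const, mul_inv_cancel₀ hd0]

theorem stmt_13 {N d : ℕ} (hN : 3 ≤ N) (hd : 2 ≤ d) :
    depQ (ghzMat N d) = Real.log d := by
  have key : ∀ i j : Fin N,
      vNEntropy (ptrace {i} (ghzMat N d)) + vNEntropy (ptrace {j} (ghzMat N d))
        - vNEntropy (ptrace {i, j} (ghzMat N d)) - vNEntropy (ghzMat N d) = Real.log d := by
    intro i j
    obtain ⟨k, hk⟩ : ∃ k, k ∉ ({i, j} : Finset (Fin N)) := by
      by_contra! h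
      have h1 : Finset.univ ⊆ ({i, j} : Finset (Fin N)) := fun x _ => h x
      have h2 := Finset.card_le_card h1
      have h3 := Finset.card_le_two (a := i) (b := j)
      simp only [Finset.card_univ, Fintype.card_fin] at h2
      omega
    have hk' := hk
    simp only [Finset.mem_insert, Finset.mem_singleton, not_or] at hk'
    rw [ghz_entropy hN hd, ptrace_entropy_s13 hd {i} ⟨k, by simpa using hk'.1⟩ ⟨i, by simp⟩,
      ptrace_entropy_s13 hd {j} ⟨k, by simpa using hk'.2⟩ ⟨j, by simp⟩,
      ptrace_entropy_s13 hd {i, j} ⟨k, hk⟩ ⟨i, by simp⟩]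
    ring
  have hset : {x | ∃ i j : Fin N, i ≠ j ∧
      x = vNEntropy (ptrace {i} (ghzMat N d)) + vNEntropy (ptrace {j} (ghzMat N d))
        - vNEntropy (ptrace {i, j} (ghzMat N d)) - vNEntropy (ghzMat N d)} = {Real.log d} := by
    ext x
    simp only [Set.mem_ofPred_eq, Set.mem_singleton_iff, key]
    constructor
    · rintro ⟨i, j, _, h⟩
      exact h
    · intro h
      exact ⟨⟨0, by omega⟩, ⟨1, by omega⟩, by simp, h⟩
  rw [depQ, hset, csInf_singleton]
end

section
/- Let N ≥ 4 be even and define the N-qubit generalized Smolin state ρ_max = 2^{−N} ( σ_0^{⊗N} + (−1)^{N/2} ( σ_1^{⊗N} + σ_2^{⊗N} + σ_3^{⊗N} ) ), where σ_1, σ_2, σ_3 are the Pauli matrices and σ_0 the 2×2 identity. Then ρ_max is a density matrix (positive semidefinite with trace 1), its von Neumann entropy equals (N−2) log 2, every (N−1)-qubit and (N−2)-qubit marginal of ρ_max is maximally mixed, and consequently its N-partite dependence attains the maximal quantum value: D_N(ρ_max) = 2 log 2. -/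
open Matrix ComplexOrder

/-- The Pauli matrices: `pauli 0 = σ_0` (identity), `pauli 1 = σ_1`,
`pauli 2 = σ_2`, `pauli 3 = σ_3`. -/
def pauli : Fin 4 → Matrix (Fin 2) (Fin 2) ℂ
  | 0 => 1
  | 1 => !![0, 1; 1, 0]
  | 2 => !![0, -Complex.I; Complex.I, 0]
  | 3 => !![1, 0; 0, -1]

/-- `N`-fold Kronecker (tensor) power `A^{⊗N}` of a `2 × 2` matrix, as a matrix
indexed by `(Fin N → Fin 2)`. -/
def tpow {N : ℕ} (A : Matrix (Fin 2) (Fin 2) ℂ) :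
    Matrix (Fin N → Fin 2) (Fin N → Fin 2) ℂ :=
  Matrix.of fun x y => ∏ i, A (x i) (y i)

/-- The `N`-qubit generalized Smolin state
`ρ_max = 2^{−N} (σ_0^{⊗N} + (−1)^{N/2} (σ_1^{⊗N} + σ_2^{⊗N} + σ_3^{⊗N}))`. -/
noncomputable def smolin (N : ℕ) : Matrix (Fin N → Fin 2) (Fin N → Fin 2) ℂ :=
  ((2 : ℂ) ^ N)⁻¹ •
    (tpow (pauli 0) +
      ((-1 : ℂ) ^ (N / 2)) • (tpow (pauli 1) + tpow (pauli 2) + tpow (pauli 3)))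

open Finset in
theorem tpow_mul {N : ℕ} (A B : Matrix (Fin 2) (Fin 2) ℂ) :
    (tpow A : Matrix (Fin N → Fin 2) (Fin N → Fin 2) ℂ) * tpow B = tpow (A * B) := by
  ext x y
  simp only [tpow, Matrix.mul_apply, Matrix.of_apply, ← Finset.prod_mul_distrib]
  rw [Fintype.prod_sum (fun i j => A (x i) j * B j (y i))]

theorem tpow_smul {N : ℕ} (c : ℂ) (A : Matrix (Fin 2) (Fin 2) ℂ) :
    (tpow (c • A) : Matrix (Fin N → Fin 2) (Fin N → Fin 2) ℂ) = c ^ N • tpow A := by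
  ext x y
  simp [tpow, Finset.prod_mul_distrib]

theorem tpow_conjTranspose {N : ℕ} (A : Matrix (Fin 2) (Fin 2) ℂ) :
    (tpow A : Matrix (Fin N → Fin 2) (Fin N → Fin 2) ℂ)ᴴ = tpow Aᴴ := by
  ext x y
  simp [tpow, Matrix.conjTranspose_apply]

theorem tpow_one {N : ℕ} :
    (tpow 1 : Matrix (Fin N → Fin 2) (Fin N → Fin 2) ℂ) = 1 := by
  ext x y
  simp [tpow, Matrix.one_apply, Finset.prod_ite_zero, funext_iff]

theorem tpow_trace {N : ℕ} (A : Matrix (Fin 2) (Fin 2) ℂ) :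
    (tpow A : Matrix (Fin N → Fin 2) (Fin N → Fin 2) ℂ).trace = A.trace ^ N := by
  simp only [tpow, Matrix.trace, Matrix.diag_apply, Matrix.of_apply]
  rw [← Fintype.prod_sum (fun (_ : Fin N) j => A j j)]
  simp

theorem ptrace_tpow {N : ℕ} (T : Finset (Fin N)) (A : Matrix (Fin 2) (Fin 2) ℂ) :
    ptrace T (tpow A) = A.trace ^ T.card • Matrix.of fun a b => ∏ i, A (a i) (b i) := by
  ext a b
  have h : ∀ c : {i : Fin N // i ∈ T} → Fin 2,
      ∏ i, A (mergeOn T a c i) (mergeOn T b c i)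
        = (∏ i, A (c i) (c i)) * ∏ i, A (a i) (b i) := by
    intro c
    rw [← Fintype.prod_subtype_mul_prod_subtype (fun i => i ∈ T)]
    congr 1
    · exact Finset.prod_congr (by ext; simp) fun i _ => by simp [mergeOn, i.2]
    · exact Finset.prod_congr rfl fun i _ => by simp [mergeOn, i.2]
  simp only [ptrace, tpow, Matrix.of_apply, h, Matrix.smul_apply, smul_eq_mul]
  rw [← Finset.sum_mul, ← Fintype.prod_sum (fun (_ : {i : Fin N // i ∈ T}) j => A j j)]
  simp [Matrix.trace]

theorem pauli_trace (k : Fin 4) (hk : k ≠ 0) : (pauli k).trace = 0 := by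
  fin_cases k <;> simp_all [pauli, Matrix.trace]

theorem pauli_herm (k : Fin 4) : (pauli k)ᴴ = pauli k := by
  ext i j
  fin_cases k <;> fin_cases i <;> fin_cases j <;> simp [pauli]

theorem ptrace_smolin {N : ℕ} (T : Finset (Fin N)) (hT : T.card ≠ 0) :
    ptrace T (smolin N) = ((2 : ℂ) ^ (N - T.card))⁻¹ • 1 := by
  have hc : T.card ≤ N := by simpa using T.card_le_univ
  have hz : ∀ k : Fin 4, k ≠ 0 → ptrace T (tpow (pauli k)) = 0 := by
    intro k hk
    rw [ptrace_tpow, pauli_trace k hk, zero_pow hT, zero_smul]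
  have h0 : ptrace T (tpow (pauli 0)) = (2 : ℂ) ^ T.card • 1 := by
    rw [ptrace_tpow]
    congr 1
    · simp [pauli]
    · ext x y
      simp [pauli, Matrix.one_apply, Finset.prod_ite_zero, funext_iff]
  have hlin : ptrace T (smolin N) = ((2 : ℂ) ^ N)⁻¹ • (ptrace T (tpow (pauli 0)) +
      ((-1 : ℂ) ^ (N / 2)) • (ptrace T (tpow (pauli 1)) + ptrace T (tpow (pauli 2))
        + ptrace T (tpow (pauli 3)))) := by
    ext a b
    simp only [ptrace, smolin, Matrix.of_apply, Matrix.smul_apply, Matrix.add_apply, smul_eq_mul,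
      Finset.mul_sum, ← Finset.sum_add_distrib]
  rw [hlin, hz 1 (by decide), hz 2 (by decide), hz 3 (by decide), h0]
  simp only [add_zero, smul_zero, smul_smul]
  congr 1
  obtain ⟨m, hm⟩ := Nat.exists_eq_add_of_le hc
  have : N - T.card = m := by omega
  rw [this]
  nth_rw 1 [hm]
  rw [pow_add]
  field_simp

theorem entropy_of_sq {n : Type*} [Fintype n] [DecidableEq n] (ρ : Matrix n n ℂ) (c : ℝ)
    (h : ρ.IsHermitian) (hsq : ρ * ρ = (c : ℂ) • ρ) (ht : ρ.trace = 1) :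
    vNEntropy ρ = - Real.log c := by
  rw [vNEntropy, dif_pos h]
  have hev : ∀ i, h.eigenvalues i * h.eigenvalues i = c * h.eigenvalues i := by
    intro i
    have h1 := h.mulVec_eigenvectorBasis i
    set v := ⇑(h.eigenvectorBasis i) with hv
    have h2 : (ρ * ρ) *ᵥ v = ((c : ℂ) • ρ) *ᵥ v := by rw [hsq]
    rw [← Matrix.mulVec_mulVec, Matrix.smul_mulVec, h1, Matrix.mulVec_smul, h1] at h2
    have hne : v ≠ 0 := by
      intro h0
      apply h.eigenvectorBasis.orthonormal.ne_zero i
      ext j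
      exact congrFun h0 j
    obtain ⟨j, hj⟩ := Function.ne_iff.mp hne
    have h3 := congrFun h2 j
    simp only [Pi.smul_apply, Complex.real_smul, smul_eq_mul, ← mul_assoc] at h3
    exact_mod_cast mul_right_cancel₀ hj h3
  have hs : ∑ i, h.eigenvalues i = 1 := by
    have := h.trace_eq_sum_eigenvalues
    rw [ht] at this
    apply Complex.ofReal_injective
    rw [Complex.ofReal_sum, Complex.ofReal_one]
    exact this.symm
  have : ∀ i, Real.negMulLog (h.eigenvalues i) = h.eigenvalues i * (- Real.log c) := by
    intro i
    by_cases h0 : h.eigenvalues i = 0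
    · simp [h0]
    · rw [mul_right_cancel₀ h0 (hev i), Real.negMulLog]; ring
  rw [Finset.sum_congr rfl fun i _ => this i, ← Finset.sum_mul, hs, one_mul]

theorem smolin_herm (N : ℕ) : (smolin N).IsHermitian := by
  simp [Matrix.IsHermitian, smolin, Matrix.conjTranspose_smul, tpow_conjTranspose, pauli_herm]

theorem smolin_trace {N : ℕ} (hN : N ≠ 0) : (smolin N).trace = 1 := by
  have h0 : (pauli 0).trace = 2 := by simp [pauli]
  simp [smolin, tpow_trace, pauli_trace, hN, h0]

theorem smolin_sq {N : ℕ} (hEven : Even N) :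
    smolin N * smolin N = (4 * ((2 : ℂ) ^ N)⁻¹) • smolin N := by
  obtain ⟨m, rfl⟩ := hEven
  have hm : (m + m) / 2 = m := by omega
  have key : ∀ (i j k : Fin 4) (c : ℂ), c ^ 2 = -1 → pauli i * pauli j = c • pauli k →
      (tpow (pauli i) : Matrix (Fin (m+m) → Fin 2) (Fin (m+m) → Fin 2) ℂ) * tpow (pauli j)
        = (-1 : ℂ) ^ m • tpow (pauli k) := by
    intro i j k c hc h
    rw [tpow_mul, h, tpow_smul, ← two_mul, pow_mul, hc]
  have hI : Complex.I ^ 2 = -1 := Complex.I_sq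
  have hI' : (-Complex.I) ^ 2 = -1 := by simp
  have p12 : pauli 1 * pauli 2 = Complex.I • pauli 3 := by
    ext i j; fin_cases i <;> fin_cases j <;> simp [pauli]
  have p21 : pauli 2 * pauli 1 = (-Complex.I) • pauli 3 := by
    ext i j; fin_cases i <;> fin_cases j <;> simp [pauli]
  have p23 : pauli 2 * pauli 3 = Complex.I • pauli 1 := by
    ext i j; fin_cases i <;> fin_cases j <;> simp [pauli]
  have p32 : pauli 3 * pauli 2 = (-Complex.I) • pauli 1 := by
    ext i j; fin_cases i <;> fin_cases j <;> simp [pauli]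
  have p31 : pauli 3 * pauli 1 = Complex.I • pauli 2 := by
    ext i j; fin_cases i <;> fin_cases j <;> simp [pauli]
  have p13 : pauli 1 * pauli 3 = (-Complex.I) • pauli 2 := by
    ext i j; fin_cases i <;> fin_cases j <;> simp [pauli]
  have sq : ∀ i : Fin 4, (tpow (pauli i) : Matrix (Fin (m+m) → Fin 2) (Fin (m+m) → Fin 2) ℂ)
      * tpow (pauli i) = 1 := by
    intro i
    rw [tpow_mul, ← tpow_one]
    congr 1
    ext a b; fin_cases i <;> fin_cases a <;> fin_cases b <;> simp [pauli]
  have k12 := key _ _ _ _ hI p12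
  have k23 := key _ _ _ _ hI p23
  have k31 := key _ _ _ _ hI p31
  have k21 := key _ _ _ _ hI' p21
  have k32 := key _ _ _ _ hI' p32
  have k13 := key _ _ _ _ hI' p13
  have h0 : (tpow (pauli 0) : Matrix (Fin (m+m) → Fin 2) (Fin (m+m) → Fin 2) ℂ) = 1 := tpow_one
  have hs : ((-1 : ℂ) ^ m) * (-1) ^ m = 1 := by rw [← mul_pow]; simp
  rw [smolin, hm, h0]
  generalize ((-1 : ℂ) ^ m) = s at *
  generalize ((2 : ℂ) ^ (m + m))⁻¹ = t at *
  simp only [smul_mul_assoc, mul_smul_comm, mul_add, add_mul, one_mul, mul_one, smul_add,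
    smul_smul, k12, k21, k23, k32, k31, k13, sq]
  have e : t * t * s * s * s = t * t * s := by linear_combination t * t * s * hs
  match_scalars <;> first | linear_combination (0:ℂ) | linear_combination (3 * t * t) * hs | linear_combination (2 * t * t * s) * hs

theorem entropy_mixed {n : Type*} [Fintype n] [DecidableEq n] (k : ℕ)
    (hk : Fintype.card n = 2 ^ k) :
    vNEntropy ((((2 : ℂ) ^ k)⁻¹) • (1 : Matrix n n ℂ)) = k * Real.log 2 := by
  rw [entropy_of_sq _ (((2 : ℝ) ^ k)⁻¹)]
  · simp
  · simp [Matrix.IsHermitian, Matrix.conjTranspose_smul]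
  · simp
  · simp [hk]

/-- for even `N ≥ 4`, the generalized Smolin state is a density
matrix, its von Neumann entropy is `(N−2) log 2`, all `(N−1)`- and `(N−2)`-qubit
marginals are maximally mixed, and its `N`-partite dependence attains the maximal
quantum value `2 log 2`. -/
theorem stmt_14 {N : ℕ} (hN : 4 ≤ N) (hEven : Even N) :
    (smolin N).PosSemidef ∧ (smolin N).trace = 1 ∧
    vNEntropy (smolin N) = ((N : ℝ) - 2) * Real.log 2 ∧
    (∀ T : Finset (Fin N), T.card = 1 →
      ptrace T (smolin N) = (((2 : ℂ) ^ (N - 1))⁻¹) • 1) ∧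
    (∀ T : Finset (Fin N), T.card = 2 →
      ptrace T (smolin N) = (((2 : ℂ) ^ (N - 2))⁻¹) • 1) ∧
    depQ (smolin N) = 2 * Real.log 2 := by
  have hN0 : N ≠ 0 := by omega
  have hH := smolin_herm N
  have hsq := smolin_sq hEven
  have ht := smolin_trace hN0
  have hS : vNEntropy (smolin N) = ((N : ℝ) - 2) * Real.log 2 := by
    rw [entropy_of_sq _ (4 * ((2 : ℝ) ^ N)⁻¹) hH (by rw [hsq]; push_cast; rfl) ht,
      Real.log_mul (by norm_num) (by positivity), Real.log_inv, Real.log_pow,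
      show (4 : ℝ) = 2 ^ 2 by norm_num, Real.log_pow]
    push_cast
    ring
  have hent : ∀ T : Finset (Fin N), T.card ≠ 0 →
      vNEntropy (ptrace T (smolin N)) = ((N - T.card : ℕ) : ℝ) * Real.log 2 := by
    intro T hT
    rw [ptrace_smolin T hT]
    apply entropy_mixed
    simp [Fintype.card_subtype_compl]
  refine ⟨?_, ht, hS, ?_, ?_, ?_⟩
  · have h1 : smolin N = ((2 : ℂ) ^ N / 4) • ((smolin N)ᴴ * smolin N) := by
      rw [hH.eq, hsq, smul_smul]
      have : (2 : ℂ) ^ N / 4 * (4 * (2 ^ N)⁻¹) = 1 := by field_simp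
      rw [this, one_smul]
    rw [h1]
    refine (Matrix.posSemidef_conjTranspose_mul_self _).smul ?_
    have : (2 : ℂ) ^ N / 4 = (((2 : ℝ) ^ N / 4 : ℝ) : ℂ) := by push_cast; rfl
    rw [this]
    exact Complex.zero_le_real.mpr (by positivity)
  · intro T hT
    rw [ptrace_smolin T (by omega), hT]
  · intro T hT
    rw [ptrace_smolin T (by omega), hT]
  · have hval : ∀ i j : Fin N, i ≠ j →
        vNEntropy (ptrace {i} (smolin N)) + vNEntropy (ptrace {j} (smolin N))
        - vNEntropy (ptrace {i, j} (smolin N)) - vNEntropy (smolin N) = 2 * Real.log 2 := by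
      intro i j hij
      rw [hent {i} (by simp), hent {j} (by simp), hent {i, j} (by simp [Finset.card_pair hij]), hS,
        Finset.card_pair hij, Finset.card_singleton, Finset.card_singleton,
        Nat.cast_sub (by omega), Nat.cast_sub (by omega)]
      push_cast
      ring
    have hset : {x | ∃ i j : Fin N, i ≠ j ∧
        x = vNEntropy (ptrace {i} (smolin N)) + vNEntropy (ptrace {j} (smolin N))
          - vNEntropy (ptrace {i, j} (smolin N)) - vNEntropy (smolin N)} = {2 * Real.log 2} := by
      ext x
      constructor
      · rintro ⟨i, j, hij, rfl⟩
        exact hval i j hij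
      · rintro rfl
        have hij : (⟨0, by omega⟩ : Fin N) ≠ ⟨1, by omega⟩ := by simp
        exact ⟨_, _, hij, (hval _ _ hij).symm⟩
    rw [depQ, hset, csInf_singleton]
end
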